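/- Let d ≥ 1, q_1, q_2 ∈ (1, ∞), 1 < β ≤ d/q_1 + 2/q_2, and let r_1, r_2 satisfy r_i(β − 1) = q_i β for i = 1, 2. Then there exists a constant N = N(d, q_1, q_2, β) such that for every R ∈ (0, ∞) and every u ∈ C_0^∞(ℝ^{d+1}) one has ‖Du‖_{E_{r_1, r_2, β−1}(C_R)} ≤ N ‖ |∂_t u| + |D²u| ‖_{E_{q_1,q_2,β}(C_R)} + N R^{-2} ‖u‖_{E_{q_1,q_2,β}(C_R)}. -/

import Mathlib

open MeasureTheory Set ENNReal Filter

noncomputable section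

/-- Euclidean space `ℝ^d`. -/
abbrev Ed (d : ℕ) := EuclideanSpace ℝ (Fin d)

/-- Points of `ℝ^{d+1}`: `z = (t, x)`. -/
abbrev Pt (d : ℕ) := ℝ × Ed d

/-- The parabolic cylinder `C_ρ(t,x)`. -/
def pCyl (d : ℕ) (ρ : ℝ) (z : Pt d) : Set (Pt d) :=
  {w | dist z.2 w.2 < ρ ∧ z.1 ≤ w.1 ∧ w.1 < z.1 + ρ ^ 2}

/-- The average `⨍_{C_ρ(z)} f`. -/
def pAvg (d : ℕ) (ρ : ℝ) (z : Pt d) (f : Pt d → ℝ≥0∞) : ℝ≥0∞ :=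
  (volume (pCyl d ρ z))⁻¹ * ∫⁻ w in pCyl d ρ z, f w

/-- The fractional maximal function `M_β f`. -/
def Mbeta (d : ℕ) (β : ℝ) (f : Pt d → ℝ≥0∞) (z : Pt d) : ℝ≥0∞ :=
  ⨆ (ρ : ℝ) (_ : 0 < ρ), ENNReal.ofReal (ρ ^ β) * pAvg d ρ z f

/-- The kernel `p_α(s, r)`. -/
def pKer (d : ℕ) (α : ℝ) (s r : ℝ) : ℝ≥0∞ :=
  if 0 < s then ENNReal.ofReal (s ^ (-(((d : ℝ) + 2 - α) / 2)) * Real.exp (-(r ^ 2) / s)) else 0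

/-- The parabolic potential `P_α f`. -/
def Palpha (d : ℕ) (α : ℝ) (f : Pt d → ℝ≥0∞) (z : Pt d) : ℝ≥0∞ :=
  ∫⁻ w : Pt d, pKer d α w.1 ‖w.2‖ * f (z.1 + w.1, z.2 + w.2)

/-- The parabolic Morrey norm `‖f‖_{E_{p,β}(Q)}`. -/
def MorreyNorm (d : ℕ) (p β : ℝ) (Q : Set (Pt d)) (f : Pt d → ℝ≥0∞) : ℝ≥0∞ :=
  ⨆ (ρ : ℝ) (_ : 0 < ρ) (z : Pt d) (_ : z ∈ Q),
    ENNReal.ofReal (ρ ^ β) * (pAvg d ρ z fun w => Q.indicator f w ^ p) ^ (1 / p)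

/-- The `L_p`-norm on `ℝ^{d+1}`. -/
def LpNormE (d : ℕ) (p : ℝ) (f : Pt d → ℝ≥0∞) : ℝ≥0∞ :=
  (∫⁻ z : Pt d, f z ^ p) ^ (1 / p)

/-- The mixed norm `‖f‖_{L_{q₁,q₂}}`. -/
def MixedNorm (d : ℕ) (q₁ q₂ : ℝ) (f : Pt d → ℝ≥0∞) : ℝ≥0∞ :=
  (∫⁻ t : ℝ, (∫⁻ x : Ed d, f (t, x) ^ q₁) ^ (q₂ / q₁)) ^ (1 / q₂)

/-- The normalized mixed norm `‖f‖_{L_{q₁,q₂}(Γ)}`. -/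
def MixedNormOn (d : ℕ) (q₁ q₂ : ℝ) (Γ : Set (Pt d)) (f : Pt d → ℝ≥0∞) : ℝ≥0∞ :=
  (MixedNorm d q₁ q₂ (Γ.indicator 1))⁻¹ * MixedNorm d q₁ q₂ (Γ.indicator f)

/-- The mixed-norm parabolic Morrey norm `‖f‖_{E_{q₁,q₂,β}(Q)}`. -/
def MixedMorrey (d : ℕ) (q₁ q₂ β : ℝ) (Q : Set (Pt d)) (f : Pt d → ℝ≥0∞) : ℝ≥0∞ :=
  ⨆ (ρ : ℝ) (_ : 0 < ρ) (z : Pt d) (_ : z ∈ Q),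
    ENNReal.ofReal (ρ ^ β) * MixedNormOn d q₁ q₂ (pCyl d ρ z) (Q.indicator f)

/-- The symmetric parabolic maximal function `M̂ f`. -/
def pMax (d : ℕ) (f : Pt d → ℝ≥0∞) (z : Pt d) : ℝ≥0∞ :=
  ⨆ (r : ℝ) (_ : 0 < r) (w : Pt d) (_ : z ∈ pCyl d r w), pAvg d r w f

/-- The time derivative `∂_t u`. -/
def timeDeriv (d : ℕ) (u : Pt d → ℝ) (z : Pt d) : ℝ :=
  fderiv ℝ u z ((1 : ℝ), (0 : Ed d))

/-- The spatial partial derivative `D_i u`. -/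
def spDeriv (d : ℕ) (i : Fin d) (u : Pt d → ℝ) (z : Pt d) : ℝ :=
  fderiv ℝ u z ((0 : ℝ), EuclideanSpace.single i (1 : ℝ))

/-- The Euclidean norm of the spatial gradient `|Du|`. -/
def gradNorm (d : ℕ) (u : Pt d → ℝ) (z : Pt d) : ℝ :=
  Real.sqrt (∑ i : Fin d, spDeriv d i u z ^ 2)

/-- The spatial Laplacian `Δu`. -/
def lap (d : ℕ) (u : Pt d → ℝ) (z : Pt d) : ℝ :=
  ∑ i : Fin d, spDeriv d i (spDeriv d i u) z

/-- The (Frobenius) norm of the spatial Hessian `|D²u|`. -/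
def hessNorm (d : ℕ) (u : Pt d → ℝ) (z : Pt d) : ℝ :=
  Real.sqrt (∑ i : Fin d, ∑ j : Fin d, spDeriv d i (spDeriv d j u) z ^ 2)


/-- volume of the unit ball -/
def om (d : ℕ) : ℝ := (volume (Metric.ball (0 : Ed d) 1)).toReal

lemma om_pos (d : ℕ) : 0 < om d := by
  unfold om
  apply ENNReal.toReal_pos
  · exact (Metric.measure_ball_pos volume (0 : Ed d) one_pos).ne'
  · exact measure_ball_lt_top.ne

lemma ofReal_om (d : ℕ) : ENNReal.ofReal (om d) = volume (Metric.ball (0 : Ed d) 1) :=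
  ENNReal.ofReal_toReal measure_ball_lt_top.ne

lemma vol_ball (d : ℕ) (x : Ed d) {r : ℝ} (hr : 0 < r) :
    volume (Metric.ball x r) = ENNReal.ofReal (om d * r ^ (d : ℝ)) := by
  rw [Measure.addHaar_ball_of_pos _ _ hr, ← ofReal_om, mul_comm, ENNReal.ofReal_mul (om_pos d).le]
  simp

lemma lint_comp_smul (d : ℕ) {g : Ed d → ℝ≥0∞} (hg : Measurable g) (c : Ed d) {σ : ℝ}
    (hσ : 0 < σ) :
    ∫⁻ y, g (c + σ • y) = ENNReal.ofReal (σ ^ (-(d : ℝ))) * ∫⁻ y, g y := by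
  have h1 : ∫⁻ y, g (c + σ • y) = ∫⁻ y, g (c + y) ∂(Measure.map (fun y : Ed d => σ • y) volume) := by
    rw [lintegral_map (by fun_prop) (by fun_prop)]
  rw [h1, Measure.map_addHaar_smul _ hσ.ne', lintegral_smul_measure,
    lintegral_add_left_eq_self g c]
  simp only [finrank_euclideanSpace, Fintype.card_fin, smul_eq_mul]
  rw [abs_of_pos (by positivity), Real.rpow_neg hσ.le, Real.rpow_natCast]

lemma lint_affine (d : ℕ) {g : Ed d → ℝ≥0∞} (hg : Measurable g) (c : Ed d) {σ : ℝ}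
    (hσ : 0 < σ) :
    ∫⁻ y in Metric.ball (0 : Ed d) 1, g (c + σ • y) =
      ENNReal.ofReal (σ ^ (-(d : ℝ))) * ∫⁻ y in Metric.ball c σ, g y := by
  rw [← lintegral_indicator measurableSet_ball, ← lintegral_indicator measurableSet_ball,
    ← lint_comp_smul d (hg.indicator measurableSet_ball) c hσ]
  congr 1; ext y
  simp only [indicator, Metric.mem_ball, dist_self_add_left, dist_zero_right, norm_smul,
    Real.norm_eq_abs, abs_of_pos hσ]
  congr 1
  rw [mul_lt_iff_lt_one_right hσ]

lemma lint_affine_time {g : ℝ → ℝ≥0∞} (hg : Measurable g) (b : ℝ) {σ : ℝ}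
    (hσ : 0 < σ) :
    ∫⁻ s in Ico (0 : ℝ) 1, g (b + σ * s) =
      ENNReal.ofReal σ⁻¹ * ∫⁻ s in Ico b (b + σ), g s := by
  have h0 : ∀ g : ℝ → ℝ≥0∞, Measurable g →
      ∫⁻ y, g (b + σ * y) = ENNReal.ofReal σ⁻¹ * ∫⁻ y, g y := by
    intro g hg
    have h1 : ∫⁻ y, g (b + σ * y) = ∫⁻ y, g (b + y) ∂(Measure.map (fun y : ℝ => σ • y) volume) := by
      rw [lintegral_map (by fun_prop) (by fun_prop)]; simp
    rw [h1, Measure.map_addHaar_smul _ hσ.ne', lintegral_smul_measure,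
      lintegral_add_left_eq_self g b]
    simp [abs_of_pos hσ]
  rw [← lintegral_indicator measurableSet_Ico, ← lintegral_indicator measurableSet_Ico,
    ← h0 _ (hg.indicator measurableSet_Ico)]
  congr 1; ext y
  simp only [indicator, mem_Ico]
  congr 1
  rw [mul_comm]
  simp [hσ]

lemma pCyl_meas (d : ℕ) (ρ : ℝ) (z : Pt d) : MeasurableSet (pCyl d ρ z) := by
  have : pCyl d ρ z = Ico z.1 (z.1 + ρ ^ 2) ×ˢ Metric.ball z.2 ρ := by
    ext w; simp [pCyl, dist_comm]; tauto
  rw [this]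
  exact measurableSet_Ico.prod measurableSet_ball

lemma mem_pCyl {d : ℕ} {ρ : ℝ} {z w : Pt d} :
    w ∈ pCyl d ρ z ↔ w.1 ∈ Ico z.1 (z.1 + ρ ^ 2) ∧ w.2 ∈ Metric.ball z.2 ρ := by
  simp [pCyl, dist_comm]; tauto

lemma mixed_ind (d : ℕ) {q₁ q₂ : ℝ} (h1 : 0 < q₁) (h2 : 0 < q₂) (ρ : ℝ) (z : Pt d)
    (f : Pt d → ℝ≥0∞) :
    MixedNorm d q₁ q₂ ((pCyl d ρ z).indicator f) =
      (∫⁻ t in Ico z.1 (z.1 + ρ ^ 2),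
        (∫⁻ x in Metric.ball z.2 ρ, f (t, x) ^ q₁) ^ (q₂ / q₁)) ^ (1 / q₂) := by
  unfold MixedNorm
  rw [← lintegral_indicator measurableSet_Ico]
  congr 2; ext t
  by_cases ht : t ∈ Ico z.1 (z.1 + ρ ^ 2)
  · rw [indicator_of_mem ht, ← lintegral_indicator measurableSet_ball]
    congr 2; ext x
    by_cases hx : x ∈ Metric.ball z.2 ρ
    · rw [indicator_of_mem hx, indicator_of_mem (show (t, x) ∈ pCyl d ρ z from mem_pCyl.2 ⟨ht, hx⟩)]
    · have hn : (t, x) ∉ pCyl d ρ z := fun h => hx (mem_pCyl.1 h).2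
      rw [indicator_of_notMem hx, indicator_of_notMem hn, ENNReal.zero_rpow_of_pos h1]
  · rw [indicator_of_notMem ht]
    have : ∀ x, (pCyl d ρ z).indicator f (t, x) = 0 := by
      intro x
      have hn : (t, x) ∉ pCyl d ρ z := fun h => ht (mem_pCyl.1 h).1
      exact indicator_of_notMem hn _
    simp [this, h1, div_pos h2 h1]

lemma mixed_one (d : ℕ) {q₁ q₂ : ℝ} (h1 : 0 < q₁) (h2 : 0 < q₂) {ρ : ℝ} (hρ : 0 < ρ) (z : Pt d) :
    MixedNorm d q₁ q₂ ((pCyl d ρ z).indicator 1) =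
      ENNReal.ofReal (om d ^ (1 / q₁) * ρ ^ ((d : ℝ) / q₁ + 2 / q₂)) := by
  rw [mixed_ind d h1 h2]
  simp only [Pi.one_apply, ENNReal.one_rpow, lintegral_const, Measure.restrict_apply_univ, one_mul]
  rw [vol_ball d _ hρ, Real.volume_Ico]
  have := om_pos d
  rw [add_sub_cancel_left, ENNReal.ofReal_rpow_of_pos (by positivity), ← ENNReal.ofReal_mul (by positivity),
    ENNReal.ofReal_rpow_of_pos (by positivity)]
  congr 1
  rw [Real.mul_rpow (by positivity) (by positivity), ← Real.rpow_mul (by positivity),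
    ← Real.rpow_natCast ρ 2, ← Real.rpow_mul (by positivity),
    Real.mul_rpow (by positivity) (by positivity), ← Real.rpow_mul (by positivity), mul_assoc, ← Real.rpow_add hρ]
  congr 2 <;> field_simp
  push_cast; ring

lemma jensen {α : Type*} [MeasurableSpace α] (μ : Measure α) {q : ℝ} (hq : 1 < q)
    {f : α → ℝ≥0∞} (hf : AEMeasurable f μ) :
    ∫⁻ a, f a ∂μ ≤ (∫⁻ a, f a ^ q ∂μ) ^ (1 / q) * (μ univ) ^ (1 - 1 / q) := by
  have hc : q.HolderConjugate (Real.conjExponent q) := Real.HolderConjugate.conjExponent hq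
  have := ENNReal.lintegral_mul_le_Lp_mul_Lq μ hc hf (aemeasurable_const (b := (1 : ℝ≥0∞)))
  simp only [Pi.mul_apply, mul_one, ENNReal.one_rpow, lintegral_const, one_mul] at this
  refine this.trans_eq ?_
  congr 2
  have := hc.inv_add_inv_eq_one
  simp only [one_div]; linarith

lemma holder_cyl (d : ℕ) {q₁ q₂ : ℝ} (h1 : 1 < q₁) (h2 : 1 < q₂) {σ : ℝ} (hσ : 0 < σ) (z : Pt d)
    {f : Pt d → ℝ≥0∞} (hf : Measurable f) :
    ∫⁻ s in Ico (0 : ℝ) 1, ∫⁻ y in Metric.ball (0 : Ed d) 1, f (z.1 + σ ^ 2 * s, z.2 + σ • y) ≤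
      ENNReal.ofReal (om d) * MixedNormOn d q₁ q₂ (pCyl d σ z) f := by
  have ho := om_pos d
  have q1p : 0 < q₁ := by linarith
  have q2p : 0 < q₂ := by linarith
  unfold MixedNormOn
  rw [mixed_one d q1p q2p hσ, mixed_ind d q1p q2p]
  set G : ℝ → ℝ≥0∞ := fun t => ∫⁻ x in Metric.ball z.2 σ, f (t, x) ^ q₁ with hG
  have hGm : Measurable G := by
    apply Measurable.lintegral_prod_right'
      (f := fun p : ℝ × Ed d => f p ^ q₁)
    exact hf.pow_const _
  have inner : ∀ s, ∫⁻ y in Metric.ball (0 : Ed d) 1, f (z.1 + σ ^ 2 * s, z.2 + σ • y) ≤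
      ENNReal.ofReal (σ ^ (-(d : ℝ) / q₁) * om d ^ (1 - 1 / q₁)) * G (z.1 + σ ^ 2 * s) ^ (1 / q₁) := by
    intro s
    refine (jensen _ h1 (by fun_prop)).trans_eq ?_
    rw [lint_affine d (g := fun x => f (z.1 + σ ^ 2 * s, x) ^ q₁) (by fun_prop) z.2 hσ,
      Measure.restrict_apply_univ, ← ofReal_om, ENNReal.mul_rpow_of_nonneg _ _ (by positivity),
      ENNReal.ofReal_rpow_of_pos (by positivity), ENNReal.ofReal_rpow_of_pos (by positivity),
      mul_right_comm, ← ENNReal.ofReal_mul (by positivity), ← Real.rpow_mul hσ.le]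
    congr 4
    ring
  refine (lintegral_mono inner).trans ?_
  rw [lintegral_const_mul _ (by fun_prop)]
  have outer : ∫⁻ s in Ico (0 : ℝ) 1, G (z.1 + σ ^ 2 * s) ^ (1 / q₁) ≤
      ENNReal.ofReal (σ ^ (-2 / q₂)) *
      (∫⁻ t in Ico z.1 (z.1 + σ ^ 2), G t ^ (q₂ / q₁)) ^ (1 / q₂) := by
    refine (jensen _ h2 (by fun_prop)).trans_eq ?_
    rw [Measure.restrict_apply_univ, Real.volume_Ico]
    simp only [← ENNReal.rpow_mul, sub_zero, ENNReal.ofReal_one, ENNReal.one_rpow, mul_one]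
    rw [lint_affine_time (g := fun t => G t ^ (1 / q₁ * q₂)) (by fun_prop) z.1 (by positivity),
      ENNReal.mul_rpow_of_nonneg _ _ (by positivity), ENNReal.ofReal_rpow_of_pos (by positivity)]
    have he : 1 / q₁ * q₂ = q₂ / q₁ := by ring
    rw [he]
    congr 2
    · rw [← Real.rpow_natCast, ← Real.rpow_neg hσ.le, ← Real.rpow_mul hσ.le]
      congr 1; push_cast; ring
  refine (mul_le_mul_right outer _).trans_eq ?_
  rw [← mul_assoc, ← mul_assoc]
  congr 1
  rw [← ENNReal.ofReal_inv_of_pos (by positivity), ← ENNReal.ofReal_mul (by positivity),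
    ← ENNReal.ofReal_mul (by positivity)]
  congr 1
  rw [mul_inv, ← Real.rpow_neg ho.le, ← Real.rpow_neg hσ.le, Real.rpow_sub ho, Real.rpow_one,
    Real.rpow_neg ho.le, neg_add, Real.rpow_add hσ]
  rw [neg_div, neg_div]
  field_simp

/-- The time-space contraction towards `z`. -/
lemma J_bound (d : ℕ) {q₁ q₂ β : ℝ} (h1 : 1 < q₁) (h2 : 1 < q₂) {R μ : ℝ} (hR : 0 < R)
    (hμ : 0 < μ) (hμ1 : μ ≤ 1) {t : ℝ} {x : Ed d} (hz : (t, x) ∈ pCyl d R 0)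
    {f : Pt d → ℝ≥0∞} (hf : Measurable f) :
    ∫⁻ s in Ico (0 : ℝ) 1, ∫⁻ y in Metric.ball (0 : Ed d) 1,
        f ((1 - μ ^ 2) * t + (μ * R) ^ 2 * s, (1 - μ) • x + (μ * R) • y) ≤
      ENNReal.ofReal (om d * (μ * R) ^ (-β)) * MixedMorrey d q₁ q₂ β (pCyl d R 0) f := by
  have hσ : 0 < μ * R := by positivity
  have ho := om_pos d
  obtain ⟨⟨ht0, ht1⟩, hx⟩ := mem_pCyl.1 hz
  simp only [Prod.fst_zero, zero_add, Prod.snd_zero, Metric.mem_ball, dist_zero_right] at ht0 ht1 hx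
  have hμ2 : μ ^ 2 ≤ 1 := by nlinarith
  set z' : Pt d := ((1 - μ ^ 2) * t, (1 - μ) • x) with hz'
  have hz'Q : z' ∈ pCyl d R 0 := by
    rw [mem_pCyl]
    refine ⟨⟨?_, ?_⟩, ?_⟩
    · simp [hz']; nlinarith
    · simp [hz']; nlinarith [sq_nonneg μ, mul_nonneg (sq_nonneg μ) ht0]
    · simp [hz', norm_smul, abs_of_nonneg (sub_nonneg.2 hμ1)]; nlinarith [norm_nonneg x]
  have hsub : pCyl d (μ * R) z' ⊆ pCyl d R 0 := by
    intro w hw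
    rw [mem_pCyl] at hw ⊢
    obtain ⟨⟨a, b⟩, c⟩ := hw
    simp only [hz', Metric.mem_ball, dist_eq_norm] at a b c
    refine ⟨⟨?_, ?_⟩, ?_⟩
    · simp; nlinarith
    · simp; nlinarith
    · simp
      calc ‖w.2‖ = ‖(w.2 - (1 - μ) • x) + (1 - μ) • x‖ := by simp
        _ ≤ ‖w.2 - (1 - μ) • x‖ + ‖(1 - μ) • x‖ := norm_add_le _ _
        _ < μ * R + (1 - μ) * R := by
          rw [norm_smul, Real.norm_eq_abs, abs_of_nonneg (sub_nonneg.2 hμ1)]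
          nlinarith [norm_nonneg x]
        _ = R := by ring
  refine (holder_cyl d h1 h2 hσ z' hf).trans ?_
  rw [ENNReal.ofReal_mul ho.le, mul_assoc]
  refine mul_le_mul_right ?_ _
  have hM : ENNReal.ofReal ((μ * R) ^ β) * MixedNormOn d q₁ q₂ (pCyl d (μ * R) z') f ≤
      MixedMorrey d q₁ q₂ β (pCyl d R 0) f := by
    have : MixedNormOn d q₁ q₂ (pCyl d (μ * R) z') f =
        MixedNormOn d q₁ q₂ (pCyl d (μ * R) z') ((pCyl d R 0).indicator f) := by
      unfold MixedNormOn
      rw [indicator_indicator, inter_eq_left.2 hsub]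
    rw [this]
    unfold MixedMorrey
    exact le_iSup₂_of_le (μ * R) hσ (le_iSup₂_of_le z' hz'Q le_rfl)
  calc _ = ENNReal.ofReal ((μ * R) ^ (-β)) * (ENNReal.ofReal ((μ * R) ^ β) *
        MixedNormOn d q₁ q₂ (pCyl d (μ * R) z') f) := by
        rw [← mul_assoc, ← ENNReal.ofReal_mul (by positivity), ← Real.rpow_add hσ]; simp
    _ ≤ _ := mul_le_mul_right hM _

lemma lint_rpow {e b : ℝ} (he : 0 < e) (hb : 0 ≤ b) :
    ∫⁻ s in Ioc 0 b, ENNReal.ofReal (s ^ (e - 1)) = ENNReal.ofReal (b ^ e / e) := by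
  have hi : IntervalIntegrable (fun s : ℝ => s ^ (e - 1)) volume 0 b :=
    intervalIntegral.intervalIntegrable_rpow' (by linarith)
  rw [← ofReal_integral_eq_lintegral_ofReal]
  · rw [← intervalIntegral.integral_of_le hb, integral_rpow (Or.inl (by linarith))]
    simp [he.ne']
  · exact (intervalIntegrable_iff_integrableOn_Ioc_of_le hb).1 hi
  · filter_upwards [ae_restrict_mem measurableSet_Ioc] with s hs
    exact Real.rpow_nonneg hs.1.le _

/-- The truncated potential in the space variable. -/
def Tpot (d : ℕ) (R l : ℝ) (g : Ed d → ℝ≥0∞) (x : Ed d) : ℝ≥0∞ :=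
  ∫⁻ μ in Ioo (0 : ℝ) l, ∫⁻ y in Metric.ball (0 : Ed d) 1, g ((1 - μ) • x + (μ * R) • y)

lemma Tpot_meas_aux (d : ℕ) (R : ℝ) {g : Ed d → ℝ≥0∞} (hg : Measurable g) :
    Measurable (fun p : Ed d × ℝ =>
      ∫⁻ y in Metric.ball (0 : Ed d) 1, g ((1 - p.2) • p.1 + (p.2 * R) • y)) := by
  apply Measurable.lintegral_prod_right'
    (f := fun p : (Ed d × ℝ) × Ed d => g ((1 - p.1.2) • p.1.1 + (p.1.2 * R) • p.2))
  exact hg.comp (Continuous.measurable (by fun_prop))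

lemma Tpot_meas (d : ℕ) (R l : ℝ) {g : Ed d → ℝ≥0∞} (hg : Measurable g) :
    Measurable (Tpot d R l g) := by
  unfold Tpot
  exact Measurable.lintegral_prod_right' (Tpot_meas_aux d R hg)

lemma Tpot_L1 (d : ℕ) (R : ℝ) {l : ℝ} (hl0 : 0 < l) (hl : l ≤ 1 / 2) {g : Ed d → ℝ≥0∞}
    (hg : Measurable g) :
    ∫⁻ x, Tpot d R l g x ≤ ENNReal.ofReal (om d * 2 ^ (d : ℝ) * l) * ∫⁻ x, g x := by
  unfold Tpot
  have ho := om_pos d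
  rw [lintegral_lintegral_swap (Tpot_meas_aux d R hg).aemeasurable]
  have key : ∀ μ ∈ Ioo (0 : ℝ) l, ∫⁻ x : Ed d, ∫⁻ y in Metric.ball (0 : Ed d) 1,
      g ((1 - μ) • x + (μ * R) • y) ≤ ENNReal.ofReal (om d * 2 ^ (d : ℝ)) * ∫⁻ x, g x := by
    intro μ hμ
    have hm : 0 < 1 - μ := by linarith [hμ.2]
    have hmm : Measurable (Function.uncurry fun (x y : Ed d) => g ((1 - μ) • x + (μ * R) • y)) :=
      hg.comp (Continuous.measurable (by fun_prop : Continuous (fun p : Ed d × Ed d =>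
        (1 - μ) • p.1 + (μ * R) • p.2)))
    rw [lintegral_lintegral_swap hmm.aemeasurable]
    have : ∀ y : Ed d, ∫⁻ x : Ed d, g ((1 - μ) • x + (μ * R) • y) ≤
        ENNReal.ofReal (2 ^ (d : ℝ)) * ∫⁻ x, g x := by
      intro y
      simp_rw [add_comm _ ((μ * R) • y)]
      rw [lint_comp_smul d hg _ hm]
      refine mul_le_mul_left (ENNReal.ofReal_le_ofReal ?_) _
      rw [Real.rpow_neg hm.le, ← Real.inv_rpow hm.le]
      refine Real.rpow_le_rpow (by positivity) ?_ (by positivity)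
      rw [inv_le_comm₀ hm (by norm_num)]
      linarith [hμ.2]
    refine (lintegral_mono this).trans_eq ?_
    rw [lintegral_const, Measure.restrict_apply_univ, ← ofReal_om, ENNReal.ofReal_mul ho.le]
    ring
  refine (setLIntegral_mono measurable_const key).trans_eq ?_
  rw [lintegral_const, Measure.restrict_apply_univ, Real.volume_Ioo, sub_zero,
    ENNReal.ofReal_mul (p := om d * 2 ^ (d : ℝ)) (by positivity)]
  ring

lemma Tpot_split (d : ℕ) (R : ℝ) {l m : ℝ} (hm : 0 ≤ m) {g : Ed d → ℝ≥0∞}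
    (x : Ed d) :
    Tpot d R l g x ≤ Tpot d R l ({x | ENNReal.ofReal m < g x}.indicator g) x +
      ENNReal.ofReal (m * l * om d) := by
  have ho := om_pos d
  unfold Tpot
  set h := {x | ENNReal.ofReal m < g x}.indicator g
  have hle : ∀ w, g w ≤ h w + ENNReal.ofReal m := by
    intro w
    by_cases hw : ENNReal.ofReal m < g w
    · have : h w = g w := indicator_of_mem (show w ∈ {x | ENNReal.ofReal m < g x} from hw) _
      rw [this]; exact le_self_add
    · exact (not_lt.1 hw).trans le_add_self
  calc _ ≤ ∫⁻ μ in Ioo (0 : ℝ) l, ((∫⁻ y in Metric.ball (0 : Ed d) 1, h ((1 - μ) • x + (μ * R) • y))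
          + ENNReal.ofReal m * ENNReal.ofReal (om d)) := by
        refine lintegral_mono fun μ => ?_
        refine (lintegral_mono fun y => hle _).trans_eq ?_
        rw [lintegral_add_right _ measurable_const, lintegral_const, Measure.restrict_apply_univ,
          ofReal_om]
    _ = _ := by
        rw [lintegral_add_right _ measurable_const, lintegral_const, Measure.restrict_apply_univ,
          Real.volume_Ioo, sub_zero, ← ENNReal.ofReal_mul hm, ← ENNReal.ofReal_mul (by positivity)]
        congr 2; ring

lemma level_set (d : ℕ) {R C A s l β : ℝ} (hC : 0 < C) (hs : 0 < s) (hl0 : 0 < l)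
    (hl : l ≤ 1 / 2) (hCl : C * (l ^ (1 - β) * A) = s / 2)
    {S : Set (Ed d)} {v : Ed d → ℝ} {g : Ed d → ℝ≥0∞} (hg : Measurable g)
    (H : ∀ x ∈ S, ENNReal.ofReal (v x) ≤
      ENNReal.ofReal C * (Tpot d R l g x + ENNReal.ofReal (l ^ (1 - β) * A))) :
    volume ({x | s < v x} ∩ S) ≤ ENNReal.ofReal (4 * C * om d * 2 ^ (d : ℝ) * l / s) *
      ∫⁻ x, {x | ENNReal.ofReal (s / (4 * C * om d * l)) < g x}.indicator g x := by
  have ho := om_pos d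
  set m := s / (4 * C * om d * l) with hm
  have hm0 : 0 < m := by positivity
  set h := {x | ENNReal.ofReal m < g x}.indicator g with hh
  have hhm : Measurable h := hg.indicator (measurableSet_lt measurable_const hg)
  have hsub : {x | s < v x} ∩ S ⊆ {x | ENNReal.ofReal (s / (4 * C)) ≤ Tpot d R l h x} := by
    rintro x ⟨hx, hxS⟩
    simp only [mem_ofPred_eq] at hx ⊢
    by_contra hcon
    push Not at hcon
    have h1 := (H x hxS).trans (mul_le_mul_right (add_le_add_left (Tpot_split d R hm0.le x) _) _)
    have h2 : ENNReal.ofReal (v x) ≤ ENNReal.ofReal s := by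
      refine h1.trans ?_
      refine (mul_le_mul_right (add_le_add_left (add_le_add_left hcon.le _) _) _).trans_eq ?_
      have e0 : 0 ≤ l ^ (1 - β) * A := by
        by_contra hneg
        push Not at hneg
        have := mul_neg_of_pos_of_neg hC hneg
        linarith
      rw [← ENNReal.ofReal_add (by positivity) (by positivity),
        ← ENNReal.ofReal_add (by positivity) e0, ← ENNReal.ofReal_mul hC.le]
      congr 1
      rw [mul_add, hCl, hm]
      field_simp
      norm_num
    have := (ENNReal.ofReal_le_ofReal_iff hs.le).1 h2
    linarith
  have hmk := mul_meas_ge_le_lintegral (μ := volume) (Tpot_meas d R l hhm) (ENNReal.ofReal (s / (4 * C)))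
  have h3 := (mul_le_mul_right (measure_mono hsub) _).trans (hmk.trans (Tpot_L1 d R hl0 hl hhm))
  calc volume ({x | s < v x} ∩ S)
      = ENNReal.ofReal (s / (4 * C))⁻¹ * (ENNReal.ofReal (s / (4 * C)) * volume ({x | s < v x} ∩ S)) := by
        rw [← mul_assoc, ← ENNReal.ofReal_mul (by positivity), inv_mul_cancel₀ (by positivity)]
        simp
    _ ≤ _ := mul_le_mul_right h3 _
    _ = _ := by
        rw [← mul_assoc, ← ENNReal.ofReal_mul (by positivity)]
        congr 2
        field_simp

lemma level_lemma (d : ℕ) {q r β C : ℝ} (hq : 1 < q) (hβ : 1 < β) (hr : r * (β - 1) = q * β)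
    (hC : 0 < C) : ∃ N : ℝ, 0 < N ∧ ∀ (R A l₀ : ℝ) (S : Set (Ed d)) (v g : Ed d → ℝ),
      0 < A → 0 < l₀ → l₀ ≤ 1 / 2 → MeasurableSet S → Measurable v → (∀ x, 0 ≤ v x) →
      Measurable g → (∀ x, 0 ≤ g x) →
      (∀ x ∈ S, ∀ l, 0 < l → l ≤ l₀ → ENNReal.ofReal (v x) ≤
        ENNReal.ofReal C * (Tpot d R l (fun x => ENNReal.ofReal (g x)) x +
          ENNReal.ofReal (l ^ (1 - β) * A))) →
      ∫⁻ x in S, ENNReal.ofReal (v x ^ r) ≤ ENNReal.ofReal N *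
        (ENNReal.ofReal ((l₀ ^ (1 - β) * A) ^ r) * volume S +
          ENNReal.ofReal (A ^ (q / (β - 1))) * ∫⁻ x, ENNReal.ofReal (g x ^ q)) := by
  have ho := om_pos d
  have hb1 : 0 < β - 1 := by linarith
  have hrr : r = q * β / (β - 1) := by field_simp; linarith
  have hr0 : 0 < r := by rw [hrr]; positivity
  set e : ℝ := (q - 1) * β / (β - 1) with he
  have he0 : 0 < e := by have : 0 < q - 1 := by linarith
                         positivity
  have her : e = r - 1 - 1 / (β - 1) := by rw [he, hrr]; field_simp; ring
  set K : ℝ := 4 * C * om d * 2 ^ (d : ℝ) with hK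
  set D : ℝ := 4 * C * om d with hD
  have hK0 : 0 < K := by positivity
  have hD0 : 0 < D := by positivity
  set N1 : ℝ := (2 * C) ^ r with hN1
  set N2 : ℝ := r * K / e * D ^ (q - 1) * (2 * C) ^ (q / (β - 1)) with hN2
  have hN10 : 0 < N1 := by positivity
  have hN20 : 0 < N2 := by positivity
  refine ⟨N1 + N2, by positivity, ?_⟩
  intro R A l₀ S v g hA hl₀ hl₀2 hS hv hv0 hg hg0 H
  set κ := 2 * C * A with hκ
  have hκ0 : 0 < κ := by positivity
  set p := 1 / (β - 1) with hp
  have hp0 : 0 < p := by positivity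
  set s₀ := κ * l₀ ^ (1 - β) with hs₀
  have hs₀0 : 0 < s₀ := by positivity
  set G : Ed d → ℝ≥0∞ := fun x => ENNReal.ofReal (g x) with hG
  have hGm : Measurable G := by fun_prop
  set lam : ℝ → ℝ := fun s => (κ / s) ^ p with hlam
  set W : ℝ → Ed d → ℝ≥0∞ := fun s x =>
    {x | ENNReal.ofReal (s / (D * lam s)) < G x}.indicator G x with hW
  have hset : ∀ s ∈ Ioi (0 : ℝ), volume.restrict S {x | s < v x} ≤
      (Ioc 0 s₀).indicator (fun _ => volume S) s + ENNReal.ofReal (K * lam s / s) * ∫⁻ x, W s x := by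
    intro s hs
    have hs : 0 < s := hs
    rw [Measure.restrict_apply (measurableSet_lt measurable_const hv)]
    by_cases hss : s ≤ s₀
    · rw [indicator_of_mem (show s ∈ Ioc 0 s₀ from ⟨hs, hss⟩)]
      exact (measure_mono inter_subset_right).trans le_self_add
    · push Not at hss
      have hlp : 0 < lam s := by simp only [hlam]; positivity
      have hl1 : lam s ≤ l₀ := by
        have : κ / s ≤ l₀ ^ (β - 1) := by
          rw [div_le_iff₀ hs]
          have : κ = l₀ ^ (β - 1) * s₀ := by
            rw [hs₀, mul_comm, mul_assoc, ← Real.rpow_add hl₀]; simp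
          rw [this]
          gcongr
        calc lam s ≤ (l₀ ^ (β - 1)) ^ p := Real.rpow_le_rpow (by positivity) this hp0.le
          _ = l₀ := by rw [← Real.rpow_mul hl₀.le, hp]; field_simp; simp
      have hCl : C * (lam s ^ (1 - β) * A) = s / 2 := by
        have : lam s ^ (1 - β) = s / κ := by
          simp only [hlam]
          rw [← Real.rpow_mul (by positivity)]
          have : p * (1 - β) = -1 := by rw [hp]; field_simp; ring
          rw [this, Real.rpow_neg_one, inv_div]
        rw [this, hκ]; field_simp
      refine (level_set d hC hs hlp (hl1.trans hl₀2) hCl hGm (fun x hx => H x hx _ hlp hl1)).trans ?_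
      exact le_add_self
  rw [lintegral_rpow_eq_lintegral_meas_lt_mul _ (Eventually.of_forall hv0) hv.aemeasurable hr0]
  have hWm : Measurable (fun p : ℝ × Ed d => W p.1 p.2) := by
    have : (fun p : ℝ × Ed d => W p.1 p.2) =
      {p : ℝ × Ed d | ENNReal.ofReal (p.1 / (D * lam p.1)) < G p.2}.indicator (fun p => G p.2) := by
      ext p; simp [hW, indicator]
    rw [this]
    refine Measurable.indicator (by fun_prop) (measurableSet_lt ?_ (by fun_prop))
    simp only [hlam]
    fun_prop
  have step1 : ∫⁻ s in Ioi (0 : ℝ), volume.restrict S {x | s < v x} * ENNReal.ofReal (s ^ (r - 1)) ≤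
      (∫⁻ s in Ioi (0 : ℝ), (Ioc 0 s₀).indicator (fun s => volume S * ENNReal.ofReal (s ^ (r - 1))) s) +
      ∫⁻ s in Ioi (0 : ℝ), ∫⁻ x, ENNReal.ofReal (K * κ ^ p * s ^ (e - 1)) * W s x := by
    rw [← lintegral_add_left]
    · refine setLIntegral_mono' measurableSet_Ioi fun s hs => ?_
      have hs' : 0 < s := hs
      refine (mul_le_mul_left (hset s hs) _).trans_eq ?_
      rw [add_mul]
      congr 1
      · by_cases h : s ∈ Ioc 0 s₀
        · simp only [indicator_of_mem h]
        · simp only [indicator_of_notMem h, zero_mul]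
      · have hWs : Measurable (fun x => W s x) :=
          hWm.comp (by fun_prop : Measurable (fun x : Ed d => (s, x)))
        have hlp : 0 ≤ K * lam s / s := by simp only [hlam]; positivity
        rw [lintegral_const_mul _ hWs, mul_right_comm, ← ENNReal.ofReal_mul hlp]
        congr 2
        simp only [hlam]
        rw [Real.div_rpow hκ0.le hs'.le, her]
        have : s ^ (r - 1 - p - 1) = s ^ (r - 1) * s⁻¹ * (s ^ p)⁻¹ := by
          rw [← Real.rpow_neg_one, ← Real.rpow_neg hs'.le, ← Real.rpow_add hs', ← Real.rpow_add hs']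
          congr 1; ring
        rw [this]
        field_simp
    · refine Measurable.indicator (by fun_prop) measurableSet_Ioc
  have first : (∫⁻ s in Ioi (0 : ℝ), (Ioc 0 s₀).indicator (fun s => volume S * ENNReal.ofReal (s ^ (r - 1))) s)
      = ENNReal.ofReal (s₀ ^ r / r) * volume S := by
    rw [lintegral_indicator measurableSet_Ioc, Measure.restrict_restrict measurableSet_Ioc,
      inter_eq_left.2 (fun s hs => hs.1), lintegral_const_mul _ (by fun_prop), lint_rpow hr0 hs₀0.le,
      mul_comm]
  have second : ∫⁻ s in Ioi (0 : ℝ), ∫⁻ x, ENNReal.ofReal (K * κ ^ p * s ^ (e - 1)) * W s x ≤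
      ENNReal.ofReal (K * κ ^ p / e * (D * κ ^ p) ^ (q - 1)) * ∫⁻ x, ENNReal.ofReal (g x ^ q) := by
    rw [lintegral_lintegral_swap (by
      refine Measurable.aemeasurable ?_
      exact Measurable.mul (by fun_prop) hWm)]
    rw [← lintegral_const_mul _ (by fun_prop)]
    refine lintegral_mono fun x => ?_
    set b : ℝ := (g x * (D * κ ^ p)) ^ ((β - 1) / β) with hb
    have hb0 : 0 ≤ b := by have := hg0 x; positivity
    calc _ ≤ ∫⁻ s in Ioi (0 : ℝ), (Ioc 0 b).indicator
            (fun s => ENNReal.ofReal (K * κ ^ p * g x) * ENNReal.ofReal (s ^ (e - 1))) s := by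
          refine setLIntegral_mono' measurableSet_Ioi fun s hs => ?_
          have hs' : 0 < s := hs
          by_cases hw : ENNReal.ofReal (s / (D * lam s)) < G x
          · have hWx : W s x = G x := by simp only [hW]; exact indicator_of_mem (by exact hw) _
            have hlt : s / (D * lam s) < g x := (ENNReal.ofReal_lt_ofReal_iff_of_nonneg
              (by simp only [hlam]; positivity)).1 hw
            have hsb : s ≤ b := by
              have h1 : s ^ (β / (β - 1)) ≤ g x * (D * κ ^ p) := by
                simp only [hlam] at hlt
                rw [Real.div_rpow hκ0.le hs'.le, div_lt_iff₀ (by positivity)] at hlt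
                have : s ^ (β / (β - 1)) = s * s ^ p := by
                  nth_rewrite 2 [← Real.rpow_one s]
                  rw [← Real.rpow_add hs']
                  congr 1; rw [hp]; field_simp; ring
                rw [this]
                have h2 := mul_le_mul_of_nonneg_right hlt.le (Real.rpow_nonneg hs'.le p)
                refine h2.trans_eq ?_
                field_simp
              calc s = (s ^ (β / (β - 1))) ^ ((β - 1) / β) := by
                    rw [← Real.rpow_mul hs'.le]
                    have : β / (β - 1) * ((β - 1) / β) = 1 := by field_simp
                    rw [this, Real.rpow_one]
                _ ≤ b := Real.rpow_le_rpow (by positivity) h1 (by positivity)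
            rw [indicator_of_mem (show s ∈ Ioc 0 b from ⟨hs', hsb⟩), hWx, hG,
              ← ENNReal.ofReal_mul (by positivity), ← ENNReal.ofReal_mul (mul_nonneg (by positivity) (hg0 x))]
            apply le_of_eq
            congr 1; ring
          · have hWx : W s x = 0 := by simp only [hW]; exact indicator_of_notMem (by exact hw) _
            rw [hWx, mul_zero]; exact zero_le
      _ = ENNReal.ofReal (K * κ ^ p * g x) * ENNReal.ofReal (b ^ e / e) := by
          rw [lintegral_indicator measurableSet_Ioc, Measure.restrict_restrict measurableSet_Ioc,
            inter_eq_left.2 (fun s hs => hs.1), lintegral_const_mul _ (by fun_prop), lint_rpow he0 hb0]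
      _ = _ := by
          rw [← ENNReal.ofReal_mul (mul_nonneg (by positivity) (hg0 x)),
            ← ENNReal.ofReal_mul (by positivity)]
          congr 1
          have hbe : b ^ e = g x ^ (q - 1) * (D * κ ^ p) ^ (q - 1) := by
            rw [hb, ← Real.rpow_mul (mul_nonneg (hg0 x) (by positivity)),
              ← Real.mul_rpow (hg0 x) (by positivity)]
            congr 1; rw [he]; field_simp
          have hgq : g x ^ q = g x * g x ^ (q - 1) := by
            rcases (hg0 x).eq_or_lt with h0 | h0
            · rw [← h0, Real.zero_rpow (by linarith)]; simp
            · nth_rewrite 2 [← Real.rpow_one (g x)]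
              rw [← Real.rpow_add h0]; congr 1; ring
          rw [hbe, hgq]; ring
  rw [first] at step1
  refine (mul_le_mul_right (step1.trans (add_le_add_right second _)) _).trans ?_
  rw [mul_add, mul_add, ← mul_assoc, ← mul_assoc, ← mul_assoc, ← mul_assoc,
    ← ENNReal.ofReal_mul hr0.le, ← ENNReal.ofReal_mul hr0.le,
    ← ENNReal.ofReal_mul (by positivity), ← ENNReal.ofReal_mul (by positivity)]
  refine add_le_add (mul_le_mul_left (ENNReal.ofReal_le_ofReal ?_) _)
    (mul_le_mul_left (ENNReal.ofReal_le_ofReal ?_) _)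
  · have : r * (s₀ ^ r / r) = N1 * (l₀ ^ (1 - β) * A) ^ r := by
      rw [hN1, ← Real.mul_rpow (by positivity) (by positivity), hs₀, hκ]
      field_simp
    rw [this]
    gcongr
    linarith
  · have : r * (K * κ ^ p / e * (D * κ ^ p) ^ (q - 1)) = N2 * A ^ (q / (β - 1)) := by
      have h1 : κ ^ p * (κ ^ p) ^ (q - 1) = (2 * C) ^ (q / (β - 1)) * A ^ (q / (β - 1)) := by
        rw [← Real.mul_rpow (by positivity) (by positivity), ← hκ, ← Real.rpow_mul hκ0.le,
          ← Real.rpow_add hκ0]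
        congr 1; rw [hp]; field_simp; ring
      rw [Real.mul_rpow hD0.le (by positivity), hN2, mul_assoc _ _ (A ^ (q / (β - 1))), ← h1]
      field_simp
    rw [this]
    gcongr
    linarith

lemma exists_bump (d : ℕ) : ∃ (φ : Ed d → ℝ) (K : ℝ), ContDiff ℝ (⊤ : ℕ∞) φ ∧ HasCompactSupport φ ∧
    0 < K ∧ (∀ y, y ∉ Metric.ball (0 : Ed d) 1 → φ y = 0) ∧
    (∀ y, y ∉ Metric.ball (0 : Ed d) 1 → fderiv ℝ φ y = 0) ∧ ∫ y, φ y = 1 ∧ (∀ y, |φ y| ≤ K) ∧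
    ∀ (i : Fin d) y, |fderiv ℝ φ y (EuclideanSpace.single i (1 : ℝ))| ≤ K := by
  let b : ContDiffBump (0 : Ed d) := ⟨1 / 4, 1 / 2, by norm_num, by norm_num⟩
  set φ := b.normed volume with hφ
  have hc : ContDiff ℝ (⊤ : ℕ∞) φ := b.contDiff_normed
  have hs : HasCompactSupport φ := b.hasCompactSupport_normed
  have hts : tsupport φ ⊆ Metric.ball (0 : Ed d) 1 := by
    rw [hφ, b.tsupport_normed_eq]
    exact Metric.closedBall_subset_ball (by norm_num [b])
  obtain ⟨K1, hK1⟩ := hs.exists_bound_of_continuous hc.continuous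
  have hdc : Continuous (fderiv ℝ φ) := hc.continuous_fderiv (by simp)
  obtain ⟨K2, hK2⟩ := (hs.fderiv (𝕜 := ℝ)).exists_bound_of_continuous hdc
  refine ⟨φ, |K1| + |K2| + 1, hc, hs, by positivity, ?_, ?_, b.integral_normed, ?_, ?_⟩
  · intro y hy
    exact image_eq_zero_of_notMem_tsupport (fun h => hy (hts h))
  · intro y hy
    exact image_eq_zero_of_notMem_tsupport (fun h => hy (hts (tsupport_fderiv_subset ℝ h)))
  · intro y
    have := hK1 y
    rw [Real.norm_eq_abs] at this
    linarith [le_abs_self K1, abs_nonneg K2]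
  · intro i y
    have h1 := (fderiv ℝ φ y).le_opNorm (EuclideanSpace.single i (1 : ℝ))
    have h2 := hK2 y
    simp only [PiLp.norm_single, norm_one, mul_one, Real.norm_eq_abs] at h1
    linarith [le_abs_self K2, abs_nonneg K1]

lemma param_ftc (d : ℕ) {h h' : ℝ → Ed d → ℝ} {φ : Ed d → ℝ} (hφ : Continuous φ)
    (hs : HasCompactSupport φ) (hh : Continuous (Function.uncurry h))
    (hh' : Continuous (Function.uncurry h')) (hd : ∀ θ y, HasDerivAt (fun θ => h θ y) (h' θ y) θ)
    {a b : ℝ} (hab : a ≤ b) :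
    ‖(∫ y, h b y * φ y) - ∫ y, h a y * φ y‖ₑ ≤
      ∫⁻ θ in Ioc a b, ‖∫ y, h' θ y * φ y‖ₑ := by
  have hy : ∀ (k : ℝ → Ed d → ℝ) (θ : ℝ), Continuous (Function.uncurry k) → Continuous (k θ) :=
    fun k θ hk => hk.comp (by fun_prop : Continuous (fun y : Ed d => (θ, y)))
  have hintg : ∀ (k : ℝ → Ed d → ℝ) (θ : ℝ), Continuous (Function.uncurry k) →
      Integrable (fun y => k θ y * φ y) := fun k θ hk =>
    ((hy k θ hk).mul hφ).integrable_of_hasCompactSupport hs.mul_left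
  have hder : ∀ θ₀, HasDerivAt (fun θ => ∫ y, h θ y * φ y) (∫ y, h' θ₀ y * φ y) θ₀ := by
    intro θ₀
    obtain ⟨M, hM⟩ := ((isCompact_closedBall θ₀ (1 : ℝ)).prod hs.isCompact).exists_bound_of_continuousOn
      (f := Function.uncurry h') hh'.continuousOn
    refine (hasDerivAt_integral_of_dominated_loc_of_deriv_le (s := Metric.ball θ₀ 1)
      (F := fun θ y => h θ y * φ y) (F' := fun θ y => h' θ y * φ y) (bound := fun y => M * |φ y|)
      (Metric.ball_mem_nhds _ one_pos) (Eventually.of_forall fun θ =>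
        (hintg h θ hh).aestronglyMeasurable)
      (hintg h θ₀ hh) (hintg h' θ₀ hh').aestronglyMeasurable ?_ ?_ ?_).2
    · refine Eventually.of_forall fun y θ hθ => ?_
      rw [norm_mul, Real.norm_eq_abs (φ y)]
      by_cases hys : y ∈ tsupport φ
      · exact mul_le_mul_of_nonneg_right (hM (θ, y) ⟨Metric.ball_subset_closedBall hθ, hys⟩) (abs_nonneg _)
      · rw [image_eq_zero_of_notMem_tsupport hys]; simp
    · exact ((hφ.integrable_of_hasCompactSupport hs).abs).const_mul M
    · exact Eventually.of_forall fun y θ _ => (hd θ y).mul_const _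
  have hcont : Continuous (fun θ => ∫ y, h' θ y * φ y) := by
    have : ∀ θ, ∫ y, h' θ y * φ y = ∫ y in tsupport φ, h' θ y * φ y := by
      intro θ
      rw [setIntegral_eq_integral_of_forall_compl_eq_zero]
      intro y hy
      rw [image_eq_zero_of_notMem_tsupport hy]; simp
    simp_rw [this]
    refine continuous_parametric_integral_of_continuous ?_ hs.isCompact
    exact hh'.mul (hφ.comp continuous_snd)
  have hftc := intervalIntegral.integral_eq_sub_of_hasDerivAt (a := a) (b := b)
    (fun θ _ => hder θ) (hcont.intervalIntegrable a b)
  rw [← hftc, intervalIntegral.integral_of_le hab]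
  exact enorm_integral_le_lintegral_enorm _

lemma spDeriv_contDiff {d : ℕ} {u : Pt d → ℝ} (hu : ContDiff ℝ (⊤ : ℕ∞) u) (i : Fin d) :
    ContDiff ℝ (⊤ : ℕ∞) (spDeriv d i u) := by
  unfold spDeriv
  exact (hu.fderiv_right (m := (⊤ : ℕ∞)) (by simp)).clm_apply contDiff_const

lemma timeDeriv_contDiff {d : ℕ} {u : Pt d → ℝ} (hu : ContDiff ℝ (⊤ : ℕ∞) u) :
    ContDiff ℝ (⊤ : ℕ∞) (timeDeriv d u) := by
  unfold timeDeriv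
  exact (hu.fderiv_right (m := (⊤ : ℕ∞)) (by simp)).clm_apply contDiff_const

lemma deriv_symm {d : ℕ} {u : Pt d → ℝ} (hu : ContDiff ℝ (⊤ : ℕ∞) u) (i : Fin d) (z : Pt d) :
    timeDeriv d (spDeriv d i u) z = spDeriv d i (timeDeriv d u) z := by
  have hsym : IsSymmSndFDerivAt ℝ u z := hu.contDiffAt.isSymmSndFDerivAt (by
    simp only [minSmoothness_of_isRCLikeNormedField]
    exact WithTop.coe_le_coe.2 le_top)
  have hdd : DifferentiableAt ℝ (fderiv ℝ u) z :=
    ((hu.fderiv_right (m := (⊤ : ℕ∞)) (by simp)).differentiable (by simp)) z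
  have key : ∀ v w : Pt d, fderiv ℝ (fun z => fderiv ℝ u z v) z w = fderiv ℝ (fderiv ℝ u) z w v := by
    intro v w
    rw [fderiv_clm_apply hdd (differentiableAt_const v)]
    simp
  unfold timeDeriv spDeriv
  rw [key, key]
  exact hsym _ _

lemma int_parts (d : ℕ) {w : Pt d → ℝ} (hw : ContDiff ℝ (⊤ : ℕ∞) w) {φ : Ed d → ℝ}
    (hφ : ContDiff ℝ (⊤ : ℕ∞) φ) (hs : HasCompactSupport φ) (i : Fin d) (τ : ℝ) (c : Ed d) {ρ : ℝ}
    (hρ : 0 < ρ) :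
    ∫ y, spDeriv d i w (τ, c + ρ • y) * φ y =
      - (ρ⁻¹ * ∫ y, w (τ, c + ρ • y) * fderiv ℝ φ y (EuclideanSpace.single i (1 : ℝ))) := by
  set e : Ed d := EuclideanSpace.single i (1 : ℝ)
  set k : Ed d → ℝ := fun y => w (τ, c + ρ • y) with hk
  have hkc : ContDiff ℝ (⊤ : ℕ∞) k := hw.comp (by fun_prop)
  have hkd : ∀ y, fderiv ℝ k y e = ρ * spDeriv d i w (τ, c + ρ • y) := by
    intro y
    have h1 : HasFDerivAt (fun y : Ed d => ((τ, c + ρ • y) : Pt d))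
        ((0 : Ed d →L[ℝ] ℝ).prod (ρ • ContinuousLinearMap.id ℝ (Ed d))) y := by
      refine (hasFDerivAt_const τ y).prodMk ?_
      exact ((hasFDerivAt_id y).const_smul ρ).const_add c
    have h2 := ((hw.differentiable (by simp)) (τ, c + ρ • y)).hasFDerivAt.comp y h1
    have h3 : fderiv ℝ k y = _ := h2.fderiv
    rw [h3]
    simp only [spDeriv, ContinuousLinearMap.comp_apply, ContinuousLinearMap.prod_apply]
    have : (((0 : Ed d →L[ℝ] ℝ) e, (ρ • ContinuousLinearMap.id ℝ (Ed d)) e) : Pt d) = ρ • ((0 : ℝ), e) := by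
      simp
    rw [this, map_smul, smul_eq_mul]
  have hkc' : Continuous (fun y => fderiv ℝ k y e) :=
    (hkc.continuous_fderiv (by simp)).clm_apply continuous_const
  have hpc' : Continuous (fun y => fderiv ℝ φ y e) :=
    (hφ.continuous_fderiv (by simp)).clm_apply continuous_const
  have hps : HasCompactSupport (fun y => fderiv ℝ φ y e) := hs.fderiv_apply (𝕜 := ℝ) e
  have ibp := integral_mul_fderiv_eq_neg_fderiv_mul_of_integrable (μ := volume) (f := k) (g := φ) (v := e)
    ((hkc'.mul hφ.continuous).integrable_of_hasCompactSupport hs.mul_left)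
    ((hkc.continuous.mul hpc').integrable_of_hasCompactSupport hps.mul_left)
    ((hkc.continuous.mul hφ.continuous).integrable_of_hasCompactSupport hs.mul_left)
    (fun y _ => hkc.differentiable (by simp) y) (fun y _ => hφ.differentiable (by simp) y)
  rw [ibp]
  simp only [hkd, mul_assoc]
  rw [integral_const_mul]
  field_simp

lemma dir_le (d : ℕ) (u : Pt d → ℝ) (i : Fin d) (z : Pt d)
    (v : Ed d) : |fderiv ℝ (spDeriv d i u) z (0, v)| ≤ ‖v‖ * hessNorm d u z := by
  have h1 : fderiv ℝ (spDeriv d i u) z (0, v) = ∑ j, v j * spDeriv d j (spDeriv d i u) z := by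
    have hv : v = ∑ j, v j • EuclideanSpace.single j (1 : ℝ) := by
      ext k; simp [Finset.sum_apply, Pi.single_apply]
    have : ((0 : ℝ), v) = ∑ j, v j • ((0 : ℝ), (EuclideanSpace.single j (1 : ℝ) : Ed d)) := by
      ext1
      · simp [Prod.fst_sum]
      · simp only [Prod.snd_sum, Prod.smul_snd]; exact hv
    rw [this, map_sum]
    simp only [map_smul, smul_eq_mul]
    rfl
  rw [h1]
  have h2 := Finset.sum_mul_sq_le_sq_mul_sq Finset.univ (fun j => v j)
    (fun j => spDeriv d j (spDeriv d i u) z)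
  apply abs_le_of_sq_le_sq _ (by unfold hessNorm; positivity)
  rw [mul_pow, hessNorm, Real.sq_sqrt (by positivity), EuclideanSpace.norm_sq_eq]
  refine h2.trans ?_
  simp only [Real.norm_eq_abs, sq_abs]
  refine mul_le_mul_of_nonneg_left ?_ (by positivity)
  refine Finset.sum_le_sum fun j _ => ?_
  exact Finset.single_le_sum (f := fun i => spDeriv d j (spDeriv d i u) z ^ 2) (fun _ _ => by positivity) (Finset.mem_univ i)

/-- right-hand side function -/
def rhsF (d : ℕ) (u : Pt d → ℝ) (z : Pt d) : ℝ := |timeDeriv d u z| + hessNorm d u z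

lemma rhsF_nonneg (d : ℕ) (u : Pt d → ℝ) (z : Pt d) : 0 ≤ rhsF d u z := by
  unfold rhsF hessNorm; positivity

lemma rhsF_cont {d : ℕ} {u : Pt d → ℝ} (hu : ContDiff ℝ (⊤ : ℕ∞) u) : Continuous (rhsF d u) := by
  unfold rhsF hessNorm
  refine (timeDeriv_contDiff hu).continuous.abs.add (Real.continuous_sqrt.comp ?_)
  refine continuous_finsetSum _ fun i _ => continuous_finsetSum _ fun j _ => ?_
  exact (spDeriv_contDiff (spDeriv_contDiff hu j) i).continuous.pow 2

lemma enorm_int_le (d : ℕ) {k : Ed d → ℝ} {f : Ed d → ℝ} {L : ℝ} (hL : 0 ≤ L)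
    (hk : ∀ y ∈ Metric.ball (0 : Ed d) 1, |k y| ≤ L * f y)
    (hk0 : ∀ y ∉ Metric.ball (0 : Ed d) 1, k y = 0) :
    ‖∫ y, k y‖ₑ ≤ ENNReal.ofReal L * ∫⁻ y in Metric.ball (0 : Ed d) 1, ENNReal.ofReal (f y) := by
  rw [← setIntegral_eq_integral_of_forall_compl_eq_zero (s := Metric.ball (0 : Ed d) 1) hk0]
  refine (enorm_integral_le_lintegral_enorm _).trans ?_
  rw [← lintegral_const_mul' _ _ ENNReal.ofReal_ne_top]
  refine setLIntegral_mono' measurableSet_ball fun y hy => ?_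
  rw [Real.enorm_eq_ofReal_abs, ← ENNReal.ofReal_mul hL]
  exact ENNReal.ofReal_le_ofReal (hk y hy)

lemma path_est (d : ℕ) {u : Pt d → ℝ} (hu : ContDiff ℝ (⊤ : ℕ∞) u) (i : Fin d) {φ : Ed d → ℝ} {K : ℝ}
    (hφ : ContDiff ℝ (⊤ : ℕ∞) φ) (hs : HasCompactSupport φ) (hK : 0 < K)
    (hφ0 : ∀ y, y ∉ Metric.ball (0 : Ed d) 1 → φ y = 0)
    (hφ0' : ∀ y, y ∉ Metric.ball (0 : Ed d) 1 → fderiv ℝ φ y = 0) (hφK : ∀ y, |φ y| ≤ K)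
    (hφK' : ∀ (i : Fin d) y, |fderiv ℝ φ y (EuclideanSpace.single i (1 : ℝ))| ≤ K)
    {R : ℝ} (hR : 0 < R) {x : Ed d} (hx : ‖x‖ < R) {τ τ' m m' : ℝ → ℝ}
    (hτ : ∀ θ, HasDerivAt τ (τ' θ) θ) (hm : ∀ θ, HasDerivAt m (m' θ) θ) (hτ' : Continuous τ')
    (hm' : Continuous m') {a b L : ℝ} (hab : a ≤ b) (hm0 : ∀ θ ∈ Ioc a b, 0 < m θ)
    (hL : ∀ θ ∈ Ioc a b, |τ' θ| * (K / (m θ * R)) + |m' θ| * (2 * R * K) ≤ L) :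
    ‖(∫ y, spDeriv d i u (τ b, (1 - m b) • x + (m b * R) • y) * φ y) -
      ∫ y, spDeriv d i u (τ a, (1 - m a) • x + (m a * R) • y) * φ y‖ₑ ≤
    ENNReal.ofReal L * ∫⁻ θ in Ioc a b, ∫⁻ y in Metric.ball (0 : Ed d) 1,
      ENNReal.ofReal (rhsF d u (τ θ, (1 - m θ) • x + (m θ * R) • y)) := by
  set w := spDeriv d i u with hw
  have hwc : ContDiff ℝ (⊤ : ℕ∞) w := spDeriv_contDiff hu i
  have hτc : Continuous τ := continuous_iff_continuousAt.2 fun θ => (hτ θ).continuousAt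
  have hmc : Continuous m := continuous_iff_continuousAt.2 fun θ => (hm θ).continuousAt
  set P : ℝ → Ed d → Pt d := fun θ y => (τ θ, (1 - m θ) • x + (m θ * R) • y) with hP
  have hPc : Continuous (fun p : ℝ × Ed d => P p.1 p.2) := by
    simp only [hP]; fun_prop
  set h' : ℝ → Ed d → ℝ := fun θ y => fderiv ℝ w (P θ y) (τ' θ, m' θ • (R • y - x)) with hh'
  have hfd : Continuous (fderiv ℝ w) := hwc.continuous_fderiv (by simp)
  have hPd : ∀ θ y, HasDerivAt (fun θ => P θ y) (τ' θ, m' θ • (R • y - x)) θ := by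
    intro θ y
    refine (hτ θ).prodMk ?_
    have h1 := (((hm θ).const_sub 1).smul_const x).add (((hm θ).mul_const R).smul_const y)
    refine h1.congr_deriv ?_
    rw [smul_sub, smul_smul, neg_smul]; abel
  have hwP : ∀ θ y, HasDerivAt (fun θ => w (P θ y)) (h' θ y) θ := fun θ y =>
    HasFDerivAt.comp_hasDerivAt (f := fun θ => P θ y) θ
      ((hwc.differentiable (by simp)) (P θ y)).hasFDerivAt (hPd θ y)
  have base := param_ftc d (h := fun θ y => w (P θ y)) (h' := h') hφ.continuous hs
    (hwc.continuous.comp hPc) ((hfd.comp hPc).clm_apply (by fun_prop))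
    hwP hab
  refine base.trans ?_
  rw [← lintegral_const_mul' _ _ ENNReal.ofReal_ne_top]
  refine setLIntegral_mono' measurableSet_Ioc fun θ hθ => ?_
  have hm1 := hm0 θ hθ
  set I := ∫⁻ y in Metric.ball (0 : Ed d) 1, ENNReal.ofReal (rhsF d u (P θ y)) with hI
  have hPy : Continuous (P θ) := hPc.comp (by fun_prop : Continuous (fun y : Ed d => (θ, y)))
  have hsplit : ∫ y, h' θ y * φ y = τ' θ * (∫ y, timeDeriv d w (P θ y) * φ y) +
      m' θ * ∫ y, fderiv ℝ w (P θ y) (0, R • y - x) * φ y := by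
    rw [← integral_const_mul, ← integral_const_mul, ← integral_add]
    · congr 1; ext y
      simp only [hh', timeDeriv]
      have : ((τ' θ, m' θ • (R • y - x)) : Pt d) =
        τ' θ • ((1 : ℝ), (0 : Ed d)) + m' θ • ((0 : ℝ), R • y - x) := by simp
      rw [this, map_add, map_smul, map_smul]
      simp only [smul_eq_mul]; ring
    · refine Integrable.const_mul (Continuous.integrable_of_hasCompactSupport ?_ hs.mul_left) _
      exact ((timeDeriv_contDiff hwc).continuous.comp hPy).mul hφ.continuous
    · refine Integrable.const_mul (Continuous.integrable_of_hasCompactSupport ?_ hs.mul_left) _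
      exact ((hfd.comp hPy).clm_apply (by fun_prop)).mul hφ.continuous
  have t1 : ‖∫ y, timeDeriv d w (P θ y) * φ y‖ₑ ≤ ENNReal.ofReal (K / (m θ * R)) * I := by
    simp only [hw, deriv_symm hu i]
    simp only [hP]
    rw [int_parts d (timeDeriv_contDiff hu) hφ hs i _ _ (mul_pos hm1 hR), enorm_neg, ← integral_const_mul]
    refine enorm_int_le d (by positivity) (fun y _ => ?_) (fun y hy => ?_)
    · rw [abs_mul, abs_mul, abs_of_pos (by positivity : 0 < (m θ * R)⁻¹)]
      have h1 := hφK' i y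
      have h2 : |timeDeriv d u (τ θ, (1 - m θ) • x + (m θ * R) • y)| ≤
          rhsF d u (τ θ, (1 - m θ) • x + (m θ * R) • y) := by
        unfold rhsF
        have : 0 ≤ hessNorm d u (τ θ, (1 - m θ) • x + (m θ * R) • y) := by unfold hessNorm; positivity
        linarith
      rw [div_eq_inv_mul, mul_assoc, mul_comm K]
      gcongr
      exact rhsF_nonneg _ _ _
    · rw [hφ0' y hy]; simp
  have t2 : ‖∫ y, fderiv ℝ w (P θ y) (0, R • y - x) * φ y‖ₑ ≤ ENNReal.ofReal (2 * R * K) * I := by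
    refine enorm_int_le d (by positivity) (fun y hy => ?_) (fun y hy => ?_)
    · rw [abs_mul]
      have h1 := dir_le d u i (P θ y) (R • y - x)
      have h2 : hessNorm d u (P θ y) ≤ rhsF d u (P θ y) := by
        unfold rhsF
        linarith [abs_nonneg (timeDeriv d u (P θ y))]
      have h0 : 0 ≤ hessNorm d u (P θ y) := by unfold hessNorm; positivity
      have h3 : ‖R • y - x‖ ≤ 2 * R := by
        refine (norm_sub_le _ _).trans ?_
        rw [norm_smul, Real.norm_eq_abs, abs_of_pos hR]
        have : ‖y‖ < 1 := by simpa using hy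
        nlinarith
      calc _ ≤ (2 * R * rhsF d u (P θ y)) * K := by
            refine mul_le_mul (h1.trans ?_) (hφK y) (abs_nonneg _) ?_
            · exact mul_le_mul h3 h2 h0 (by positivity)
            · exact mul_nonneg (by positivity) (rhsF_nonneg _ _ _)
        _ = _ := by ring
    · rw [hφ0 y hy]; simp
  rw [hsplit]
  refine (enorm_add_le _ _).trans ?_
  rw [enorm_mul, enorm_mul, Real.enorm_eq_ofReal_abs (τ' θ), Real.enorm_eq_ofReal_abs (m' θ)]
  calc _ ≤ ENNReal.ofReal |τ' θ| * (ENNReal.ofReal (K / (m θ * R)) * I) +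
        ENNReal.ofReal |m' θ| * (ENNReal.ofReal (2 * R * K) * I) :=
        add_le_add (mul_le_mul_right t1 _) (mul_le_mul_right t2 _)
    _ = ENNReal.ofReal (|τ' θ| * (K / (m θ * R)) + |m' θ| * (2 * R * K)) * I := by
        rw [← mul_assoc, ← mul_assoc, ← ENNReal.ofReal_mul (abs_nonneg _),
          ← ENNReal.ofReal_mul (abs_nonneg _), ← add_mul, ENNReal.ofReal_add (by positivity) (by positivity)]
    _ ≤ _ := mul_le_mul_left (ENNReal.ofReal_le_ofReal (hL θ hθ)) _

/-- The mollified derivative. -/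
def Vf (d : ℕ) (u : Pt d → ℝ) (i : Fin d) (φ : Ed d → ℝ) (R : ℝ) (x : Ed d) (τ m : ℝ) : ℝ :=
  ∫ y, spDeriv d i u (τ, (1 - m) • x + (m * R) • y) * φ y

/-- The bump data. -/
structure BumpD (d : ℕ) (φ : Ed d → ℝ) (K : ℝ) : Prop where
  smooth : ContDiff ℝ (⊤ : ℕ∞) φ
  supp : HasCompactSupport φ
  pos : 0 < K
  zero : ∀ y, y ∉ Metric.ball (0 : Ed d) 1 → φ y = 0
  zero' : ∀ y, y ∉ Metric.ball (0 : Ed d) 1 → fderiv ℝ φ y = 0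
  int : ∫ y, φ y = 1
  bd : ∀ y, |φ y| ≤ K
  bd' : ∀ (i : Fin d) y, |fderiv ℝ φ y (EuclideanSpace.single i (1 : ℝ))| ≤ K

/-- The space-time integral over the unit ball. -/
def Jf (d : ℕ) (f : Pt d → ℝ) (R : ℝ) (x : Ed d) (τ m : ℝ) : ℝ≥0∞ :=
  ∫⁻ y in Metric.ball (0 : Ed d) 1, ENNReal.ofReal (f (τ, (1 - m) • x + (m * R) • y))

lemma Jf_meas (d : ℕ) {f : Pt d → ℝ} (hf : Continuous f) (R : ℝ) (x : Ed d) {T M : ℝ × ℝ → ℝ}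
    (hT : Continuous T) (hM : Continuous M) : Measurable (fun p : ℝ × ℝ => Jf d f R x (T p) (M p)) := by
  unfold Jf
  apply Measurable.lintegral_prod_right'
    (f := fun p : (ℝ × ℝ) × Ed d => ENNReal.ofReal (f (T p.1, (1 - M p.1) • x + (M p.1 * R) • p.2)))
  exact (Continuous.measurable (by fun_prop)).ennreal_ofReal

lemma Jf_meas1 (d : ℕ) {f : Pt d → ℝ} (hf : Continuous f) (R : ℝ) (x : Ed d) {T M : ℝ → ℝ}
    (hT : Continuous T) (hM : Continuous M) : Measurable (fun p : ℝ => Jf d f R x (T p) (M p)) := by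
  unfold Jf
  apply Measurable.lintegral_prod_right'
    (f := fun p : ℝ × Ed d => ENNReal.ofReal (f (T p.1, (1 - M p.1) • x + (M p.1 * R) • p.2)))
  exact (Continuous.measurable (by fun_prop)).ennreal_ofReal

lemma step0 (d : ℕ) {u : Pt d → ℝ} (i : Fin d) {φ : Ed d → ℝ} {K : ℝ}
    (hb : BumpD d φ K) (R : ℝ) (x : Ed d) (t : ℝ) : Vf d u i φ R x t 0 = spDeriv d i u (t, x) := by
  unfold Vf
  simp [integral_const_mul, hb.int]

lemma step1 (d : ℕ) {u : Pt d → ℝ} (hu : ContDiff ℝ (⊤ : ℕ∞) u) (i : Fin d) {φ : Ed d → ℝ} {K : ℝ}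
    (hb : BumpD d φ K) {R : ℝ} (hR : 0 < R) {x : Ed d} (hx : ‖x‖ < R) (t : ℝ) {l : ℝ} (hl : 0 < l) :
    ‖Vf d u i φ R x t l - Vf d u i φ R x t 0‖ₑ ≤
      ENNReal.ofReal (2 * R * K) * Tpot d R l (fun x' => ENNReal.ofReal (rhsF d u (t, x'))) x := by
  have h := path_est d hu i hb.smooth hb.supp hb.pos hb.zero hb.zero' hb.bd hb.bd' hR hx
    (τ := fun _ => t) (τ' := fun _ => 0) (m := fun θ => θ) (m' := fun _ => 1)
    (fun θ => hasDerivAt_const θ t) (fun θ => hasDerivAt_id θ) continuous_const continuous_const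
    hl.le (fun θ hθ => hθ.1) (L := 2 * R * K) (fun θ hθ => by simp)
  unfold Vf Tpot
  rw [setLIntegral_congr Ioo_ae_eq_Ioc]
  exact h

lemma step2 (d : ℕ) {u : Pt d → ℝ} (hu : ContDiff ℝ (⊤ : ℕ∞) u) (i : Fin d) {φ : Ed d → ℝ} {K : ℝ}
    (hb : BumpD d φ K) {R : ℝ} (hR : 0 < R) {x : Ed d} (hx : ‖x‖ < R) {t : ℝ} (ht : t ∈ Ico 0 (R ^ 2))
    {l s : ℝ} (hl : 0 < l) (hs : s ∈ Ico (0 : ℝ) 1) :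
    ‖Vf d u i φ R x ((1 - l ^ 2) * t + (l * R) ^ 2 * s) l - Vf d u i φ R x t l‖ₑ ≤
      ENNReal.ofReal (K * (l * R)) *
        ∫⁻ s in Ico (0 : ℝ) 1, Jf d (rhsF d u) R x ((1 - l ^ 2) * t + (l * R) ^ 2 * s) l := by
  have key : ∀ a ∈ Ico (0 : ℝ) 1, ∀ b ∈ Ico (0 : ℝ) 1, a ≤ b →
    ‖Vf d u i φ R x ((1 - l ^ 2) * t + (l * R) ^ 2 * b) l -
      Vf d u i φ R x ((1 - l ^ 2) * t + (l * R) ^ 2 * a) l‖ₑ ≤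
      ENNReal.ofReal (K * (l * R)) *
        ∫⁻ s in Ico (0 : ℝ) 1, Jf d (rhsF d u) R x ((1 - l ^ 2) * t + (l * R) ^ 2 * s) l := by
    intro a ha b hb' hab
    have h := path_est d hu i hb.smooth hb.supp hb.pos hb.zero hb.zero' hb.bd hb.bd' hR hx
      (τ := fun θ => (1 - l ^ 2) * t + (l * R) ^ 2 * θ) (τ' := fun _ => (l * R) ^ 2)
      (m := fun θ => l) (m' := fun _ => 0)
      (fun θ => by simpa using ((hasDerivAt_id θ).const_mul ((l * R) ^ 2)).const_add ((1 - l ^ 2) * t))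
      (fun θ => hasDerivAt_const θ l) continuous_const continuous_const
      hab (fun θ hθ => hl) (L := K * (l * R)) (fun θ hθ => by
        rw [abs_of_pos (by positivity)]
        apply le_of_eq; field_simp; simp; ring)
    refine h.trans (mul_le_mul_right (lintegral_mono_set ?_) _)
    intro θ hθ
    exact ⟨ha.1.trans hθ.1.le, hθ.2.trans_lt hb'.2⟩
  have h0 : t / R ^ 2 ∈ Ico (0 : ℝ) 1 :=
    ⟨div_nonneg ht.1 (by positivity), (div_lt_one (by positivity)).2 ht.2⟩
  have h1 : (1 - l ^ 2) * t + (l * R) ^ 2 * (t / R ^ 2) = t := by field_simp; ring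
  rcases le_total s (t / R ^ 2) with h | h
  · have := key s hs _ h0 h
    rw [h1] at this
    rwa [← neg_sub, enorm_neg]
  · have := key _ h0 s hs h
    rwa [h1] at this

lemma step3 (d : ℕ) {u : Pt d → ℝ} (hu : ContDiff ℝ (⊤ : ℕ∞) u) (i : Fin d) {φ : Ed d → ℝ} {K : ℝ}
    (hb : BumpD d φ K) {R : ℝ} (hR : 0 < R) {x : Ed d} (hx : ‖x‖ < R) {t : ℝ} (ht : t ∈ Ico 0 (R ^ 2))
    {l s : ℝ} (hl : 0 < l) (hl1 : l ≤ 1) (hs : s ∈ Ico (0 : ℝ) 1) :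
    ‖Vf d u i φ R x (R ^ 2 * s) 1 - Vf d u i φ R x ((1 - l ^ 2) * t + (l * R) ^ 2 * s) l‖ₑ ≤
      ENNReal.ofReal (4 * R * K) *
        ∫⁻ θ in Ioc l 1, Jf d (rhsF d u) R x ((1 - θ ^ 2) * t + (θ * R) ^ 2 * s) θ := by
  have hK := hb.pos
  have h := path_est d hu i hb.smooth hb.supp hb.pos hb.zero hb.zero' hb.bd hb.bd' hR hx
      (τ := fun θ => (1 - θ ^ 2) * t + (θ * R) ^ 2 * s) (τ' := fun θ => 2 * θ * (R ^ 2 * s - t))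
      (m := fun θ => θ) (m' := fun _ => 1)
      (fun θ => by
        have h1 := (((hasDerivAt_id θ).pow 2).const_mul (R ^ 2 * s - t)).const_add t
        have h2 : (fun x => t + (R ^ 2 * s - t) * (id ^ 2) x) = fun θ => (1 - θ ^ 2) * t + (θ * R) ^ 2 * s := by
          funext y; simp; ring
        rw [h2] at h1
        refine h1.congr_deriv ?_
        simp; ring)
      (fun θ => hasDerivAt_id θ) (by fun_prop) continuous_const
      hl1 (fun θ hθ => hl.trans hθ.1) (L := 4 * R * K) (fun θ hθ => by
        have hθ0 : 0 < θ := hl.trans hθ.1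
        have h2 : |R ^ 2 * s - t| ≤ R ^ 2 := by
          have := ht.1; have := ht.2; have := hs.1
          have : R ^ 2 * s ≤ R ^ 2 := mul_le_of_le_one_right (by positivity) hs.2.le
          have : 0 ≤ R ^ 2 * s := by positivity
          rw [abs_le]; constructor <;> linarith
        rw [abs_mul, abs_of_pos (by positivity : 0 < 2 * θ)]
        have : 2 * θ * |R ^ 2 * s - t| * (K / (θ * R)) ≤ 2 * θ * R ^ 2 * (K / (θ * R)) := by gcongr
        have h3 : 2 * θ * R ^ 2 * (K / (θ * R)) = 2 * R * K := by field_simp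
        simp; linarith)
  simp only [one_pow, sub_self, zero_mul, zero_add, one_mul] at h
  unfold Vf Jf
  simp only [sub_self, one_mul]
  exact h

lemma step4 (d : ℕ) {u : Pt d → ℝ} (hu : ContDiff ℝ (⊤ : ℕ∞) u) (i : Fin d) {φ : Ed d → ℝ} {K : ℝ}
    (hb : BumpD d φ K) {R : ℝ} (hR : 0 < R) (x : Ed d) (τ : ℝ) :
    ‖Vf d u i φ R x τ 1‖ₑ ≤ ENNReal.ofReal (K / R) * Jf d (fun z => |u z|) R x τ 1 := by
  have hK := hb.pos
  unfold Vf Jf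
  simp only [sub_self, one_mul]
  rw [int_parts d hu hb.smooth hb.supp i _ _ hR, enorm_neg, ← integral_const_mul]
  refine enorm_int_le d (by positivity) (fun y _ => ?_) (fun y hy => ?_)
  · rw [abs_mul, abs_mul, abs_of_pos (by positivity : 0 < R⁻¹)]
    calc R⁻¹ * (|u (τ, (0:ℝ) • x + R • y)| * |fderiv ℝ φ y (EuclideanSpace.single i (1 : ℝ))|)
        ≤ R⁻¹ * (|u (τ, (0:ℝ) • x + R • y)| * K) := by gcongr; exact hb.bd' i y
      _ = _ := by ring
  · rw [hb.zero' y hy]; simp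

lemma point_est (d : ℕ) {q₁ q₂ β : ℝ} (h1 : 1 < q₁) (h2 : 1 < q₂) (hβ : 1 < β) :
    ∃ C : ℝ, 0 < C ∧ ∀ (R : ℝ) (u : Pt d → ℝ) (a t : ℝ) (x : Ed d) (l : ℝ) (i : Fin d), 0 < R →
      ContDiff ℝ (⊤ : ℕ∞) u → 0 < a →
      MixedMorrey d q₁ q₂ β (pCyl d R 0) (fun z => ENNReal.ofReal (rhsF d u z)) +
        ENNReal.ofReal (R ^ (-2 : ℝ)) *
          MixedMorrey d q₁ q₂ β (pCyl d R 0) (fun z => ENNReal.ofReal |u z|) ≤ ENNReal.ofReal a →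
      (t, x) ∈ pCyl d R 0 → 0 < l → l ≤ 1 →
      ‖spDeriv d i u (t, x)‖ₑ ≤ ENNReal.ofReal C * (ENNReal.ofReal R *
        Tpot d R l (fun x' => ENNReal.ofReal (rhsF d u (t, x'))) x +
          ENNReal.ofReal ((l * R) ^ (1 - β) * a)) := by
  obtain ⟨φ, K, hφ, hs, hK, hφ0, hφ0', hintg, hbd, hbd'⟩ := exists_bump d
  have hb : BumpD d φ K := ⟨hφ, hs, hK, hφ0, hφ0', hintg, hbd, hbd'⟩
  have ho := om_pos d
  have hβ1 : 0 < β - 1 := by linarith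
  refine ⟨2 * K + K * om d * (2 + 4 / (β - 1)), by positivity, ?_⟩
  intro R u a t x l i hR hu ha hA hz hl hl1
  obtain ⟨hF, hU⟩ : MixedMorrey d q₁ q₂ β (pCyl d R 0) (fun z => ENNReal.ofReal (rhsF d u z)) ≤
      ENNReal.ofReal a ∧ ENNReal.ofReal (R ^ (-2 : ℝ)) *
          MixedMorrey d q₁ q₂ β (pCyl d R 0) (fun z => ENNReal.ofReal |u z|) ≤ ENNReal.ofReal a :=
    ⟨le_self_add.trans hA, le_add_self.trans hA⟩
  have hx : ‖x‖ < R := by simpa using (mem_pCyl.1 hz).2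
  have ht : t ∈ Ico 0 (R ^ 2) := by simpa using (mem_pCyl.1 hz).1
  set F := rhsF d u with hFd
  have hFc : Continuous F := rhsF_cont hu
  have hJ : ∀ μ, 0 < μ → μ ≤ 1 → ∫⁻ s in Ico (0 : ℝ) 1,
      Jf d F R x ((1 - μ ^ 2) * t + (μ * R) ^ 2 * s) μ ≤ ENNReal.ofReal (om d * (μ * R) ^ (-β) * a) := by
    intro μ hμ hμ1
    refine (J_bound d (β := β) h1 h2 hR hμ hμ1 hz (f := fun z => ENNReal.ofReal (F z))
      hFc.measurable.ennreal_ofReal).trans ?_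
    rw [ENNReal.ofReal_mul (p := om d * (μ * R) ^ (-β)) (by positivity)]
    exact mul_le_mul_right hF _
  set T := Tpot d R l (fun x' => ENNReal.ofReal (F (t, x'))) x with hT
  set W := (l * R) ^ (1 - β) * a with hW
  have hWp : 0 < W := by positivity
  have tri : ∀ s ∈ Ico (0 : ℝ) 1, ‖spDeriv d i u (t, x)‖ₑ ≤
      (ENNReal.ofReal (2 * R * K) * T + ENNReal.ofReal (K * (l * R)) *
        ∫⁻ s in Ico (0 : ℝ) 1, Jf d F R x ((1 - l ^ 2) * t + (l * R) ^ 2 * s) l) +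
      (ENNReal.ofReal (4 * R * K) *
        (∫⁻ θ in Ioc l 1, Jf d F R x ((1 - θ ^ 2) * t + (θ * R) ^ 2 * s) θ) +
      ENNReal.ofReal (K / R) * Jf d (fun z => |u z|) R x (R ^ 2 * s) 1) := by
    intro s hs'
    have e1 := step1 d hu i hb hR hx t hl
    have e2 := step2 d hu i hb hR hx ht hl hs'
    have e3 := step3 d hu i hb hR hx ht hl hl1 hs'
    have e4 := step4 d hu i hb hR x (R ^ 2 * s)
    rw [step0 d i hb] at e1
    set p0 := spDeriv d i u (t, x)
    set p1 := Vf d u i φ R x t l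
    set p2 := Vf d u i φ R x ((1 - l ^ 2) * t + (l * R) ^ 2 * s) l
    set p3 := Vf d u i φ R x (R ^ 2 * s) 1
    have : p0 = (-(p1 - p0) + -(p2 - p1)) + (-(p3 - p2) + p3) := by ring
    rw [this]
    refine (enorm_add_le _ _).trans (add_le_add ((enorm_add_le _ _).trans ?_) ((enorm_add_le _ _).trans ?_))
    · rw [enorm_neg, enorm_neg]; exact add_le_add e1 e2
    · rw [enorm_neg]; exact add_le_add e3 e4
  have hmJ3 : Measurable (fun p : ℝ × ℝ => Jf d F R x ((1 - p.2 ^ 2) * t + (p.2 * R) ^ 2 * p.1) p.2) :=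
    Jf_meas d hFc R x (by fun_prop) (by fun_prop)
  have hm3 : Measurable (fun s : ℝ => ∫⁻ θ in Ioc l 1, Jf d F R x ((1 - θ ^ 2) * t + (θ * R) ^ 2 * s) θ) :=
    hmJ3.lintegral_prod_right'
  have hvol : volume (Ico (0 : ℝ) 1) = 1 := by simp
  have I : ‖spDeriv d i u (t, x)‖ₑ ≤
      (ENNReal.ofReal (2 * R * K) * T + ENNReal.ofReal (K * (l * R)) *
        ∫⁻ s in Ico (0 : ℝ) 1, Jf d F R x ((1 - l ^ 2) * t + (l * R) ^ 2 * s) l) +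
      (ENNReal.ofReal (4 * R * K) *
        (∫⁻ s in Ico (0 : ℝ) 1, ∫⁻ θ in Ioc l 1, Jf d F R x ((1 - θ ^ 2) * t + (θ * R) ^ 2 * s) θ) +
      ENNReal.ofReal (K / R) * ∫⁻ s in Ico (0 : ℝ) 1, Jf d (fun z => |u z|) R x (R ^ 2 * s) 1) := by
    have := setLIntegral_mono' (μ := volume) measurableSet_Ico tri
    rw [setLIntegral_const, hvol, mul_one, lintegral_add_left measurable_const, setLIntegral_const,
      hvol, mul_one, lintegral_add_left (hm3.const_mul _), lintegral_const_mul _ hm3,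
      lintegral_const_mul _ (Jf_meas1 d hu.continuous.abs R x (by fun_prop) (by fun_prop))] at this
    exact this
  have b2 : ENNReal.ofReal (K * (l * R)) *
        ∫⁻ s in Ico (0 : ℝ) 1, Jf d F R x ((1 - l ^ 2) * t + (l * R) ^ 2 * s) l ≤
      ENNReal.ofReal (K * om d * W) := by
    refine (mul_le_mul_right (hJ l hl hl1) _).trans_eq ?_
    rw [← ENNReal.ofReal_mul (by positivity), hW]
    congr 1
    have : (l * R) ^ (1 - β) = (l * R) * (l * R) ^ (-β) := by
      rw [sub_eq_add_neg, Real.rpow_add (by positivity), Real.rpow_one]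
    rw [this]; ring
  have b3 : (∫⁻ s in Ico (0 : ℝ) 1, ∫⁻ θ in Ioc l 1, Jf d F R x ((1 - θ ^ 2) * t + (θ * R) ^ 2 * s) θ) ≤
      ENNReal.ofReal (om d * a * (R ^ (-β) * (l ^ (1 - β) / (β - 1)))) := by
    rw [lintegral_lintegral_swap hmJ3.aemeasurable]
    refine (setLIntegral_mono' (g := fun θ => ENNReal.ofReal (om d * a) * ENNReal.ofReal (R ^ (-β) * θ ^ (-β)))
      measurableSet_Ioc (fun θ hθ => ?_)).trans ?_
    · refine (hJ θ (hl.trans hθ.1) hθ.2).trans_eq ?_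
      rw [← ENNReal.ofReal_mul (by positivity), Real.mul_rpow (hl.trans hθ.1).le hR.le]
      congr 1; ring
    · rw [lintegral_const_mul _ (by fun_prop), ENNReal.ofReal_mul (p := om d * a) (by positivity)]
      refine mul_le_mul_right ?_ _
      rw [← ofReal_integral_eq_lintegral_ofReal]
      · refine ENNReal.ofReal_le_ofReal ?_
        rw [integral_const_mul]
        refine mul_le_mul_of_nonneg_left ?_ (by positivity)
        rw [← intervalIntegral.integral_of_le hl1, integral_rpow (Or.inr ⟨by linarith, by
          rw [uIcc_of_le hl1]; intro h; linarith [h.1]⟩), Real.one_rpow]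
        have : (1 - l ^ (-β + 1)) / (-β + 1) = (l ^ (1 - β) - 1) / (β - 1) := by
          rw [show -β + 1 = -(β - 1) by ring, div_neg, ← neg_div, show 1 - β = -(β - 1) by ring]; ring_nf
        rw [this]
        gcongr; linarith
      · refine Integrable.const_mul ?_ _
        refine ((intervalIntegrable_iff_integrableOn_Ioc_of_le hl1).1 ?_)
        exact intervalIntegral.intervalIntegrable_rpow (Or.inr (by
          rw [uIcc_of_le hl1]; intro h; linarith [h.1]))
      · filter_upwards [ae_restrict_mem measurableSet_Ioc] with s hs
        have := hl.trans hs.1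
        positivity
  have b3' : ENNReal.ofReal (4 * R * K) * (∫⁻ s in Ico (0 : ℝ) 1, ∫⁻ θ in Ioc l 1,
      Jf d F R x ((1 - θ ^ 2) * t + (θ * R) ^ 2 * s) θ) ≤
      ENNReal.ofReal (K * om d * (4 / (β - 1)) * W) := by
    refine (mul_le_mul_right b3 _).trans_eq ?_
    rw [← ENNReal.ofReal_mul (by positivity), hW, Real.mul_rpow hl.le hR.le]
    congr 1
    have : R ^ (1 - β) = R * R ^ (-β) := by
      rw [sub_eq_add_neg, Real.rpow_add (by positivity), Real.rpow_one]
    rw [this]; ring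
  have b4 : ENNReal.ofReal (K / R) * ∫⁻ s in Ico (0 : ℝ) 1, Jf d (fun z => |u z|) R x (R ^ 2 * s) 1 ≤
      ENNReal.ofReal (K * om d * W) := by
    have h := J_bound d (β := β) h1 h2 hR one_pos le_rfl hz (f := fun z => ENNReal.ofReal |u z|)
      hu.continuous.abs.measurable.ennreal_ofReal
    have h' : ∫⁻ s in Ico (0 : ℝ) 1, Jf d (fun z => |u z|) R x (R ^ 2 * s) 1 ≤
        ENNReal.ofReal (om d * R ^ (-β)) * MixedMorrey d q₁ q₂ β (pCyl d R 0) (fun z => ENNReal.ofReal |u z|) := by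
      simpa [Jf] using h
    refine (mul_le_mul_right h' _).trans ?_
    have e : ENNReal.ofReal (K / R) * (ENNReal.ofReal (om d * R ^ (-β)) *
        MixedMorrey d q₁ q₂ β (pCyl d R 0) (fun z => ENNReal.ofReal |u z|)) =
        ENNReal.ofReal (K * om d * R ^ (1 - β)) * (ENNReal.ofReal (R ^ (-2 : ℝ)) *
        MixedMorrey d q₁ q₂ β (pCyl d R 0) (fun z => ENNReal.ofReal |u z|)) := by
      rw [← mul_assoc, ← mul_assoc, ← ENNReal.ofReal_mul (by positivity), ← ENNReal.ofReal_mul (by positivity)]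
      congr 2
      have e1 : R ^ (1 - β) = R * R ^ (-β) := by
        rw [sub_eq_add_neg, Real.rpow_add (by positivity), Real.rpow_one]
      have e2 : R ^ (-2 : ℝ) = (R ^ 2)⁻¹ := by
        rw [Real.rpow_neg hR.le]; norm_cast
      rw [e1, e2]; field_simp
    rw [e]
    refine (mul_le_mul_right hU _).trans ?_
    rw [← ENNReal.ofReal_mul (by positivity)]
    refine ENNReal.ofReal_le_ofReal ?_
    have : R ^ (1 - β) ≤ (l * R) ^ (1 - β) :=
      Real.rpow_le_rpow_of_nonpos (by positivity) (by nlinarith) (by linarith)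
    rw [hW, ← mul_assoc]
    gcongr
  refine I.trans ?_
  have c1 : ENNReal.ofReal (2 * R * K) * T = ENNReal.ofReal (2 * K) * (ENNReal.ofReal R * T) := by
    rw [← mul_assoc, ← ENNReal.ofReal_mul (by positivity)]; congr 2; ring
  refine (add_le_add (add_le_add le_rfl b2) (add_le_add b3' b4)).trans ?_
  rw [c1, mul_add, add_assoc]
  refine add_le_add (mul_le_mul_left (ENNReal.ofReal_le_ofReal ?_) _) ?_
  · have : 0 ≤ K * om d * (2 + 4 / (β - 1)) := by positivity
    linarith
  · rw [← ENNReal.ofReal_add (by positivity) (by positivity), ← ENNReal.ofReal_add (by positivity) (by positivity),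
      ← ENNReal.ofReal_mul (by positivity)]
    refine ENNReal.ofReal_le_ofReal ?_
    have : 0 ≤ 2 * K * W := by positivity
    linarith

lemma gradNorm_le (d : ℕ) (u : Pt d → ℝ) (z : Pt d) :
    ENNReal.ofReal (gradNorm d u z) ≤ ∑ i : Fin d, ‖spDeriv d i u z‖ₑ := by
  have h : gradNorm d u z ≤ ∑ i : Fin d, |spDeriv d i u z| := by
    unfold gradNorm
    refine Real.sqrt_le_iff.2 ⟨Finset.sum_nonneg fun _ _ => abs_nonneg _, ?_⟩
    have := Finset.sum_sq_le_sq_sum_of_nonneg (s := Finset.univ) (f := fun i => |spDeriv d i u z|)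
      (fun i _ => abs_nonneg _)
    simpa using this
  refine (ENNReal.ofReal_le_ofReal h).trans_eq ?_
  rw [ENNReal.ofReal_sum_of_nonneg fun _ _ => abs_nonneg _]
  refine Finset.sum_congr rfl fun i _ => ?_
  rw [Real.enorm_eq_ofReal_abs]

lemma gradNorm_meas {d : ℕ} {u : Pt d → ℝ} (hu : ContDiff ℝ (⊤ : ℕ∞) u) : Continuous (gradNorm d u) := by
  unfold gradNorm
  have : ∀ i, Continuous (spDeriv d i u) := fun i => (spDeriv_contDiff hu i).continuous
  fun_prop

/-- Standing hypothesis: `a` dominates the right-hand side. -/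
def HypA (d : ℕ) (q₁ q₂ β R a : ℝ) (u : Pt d → ℝ) : Prop :=
  MixedMorrey d q₁ q₂ β (pCyl d R 0) (fun z => ENNReal.ofReal (rhsF d u z)) +
    ENNReal.ofReal (R ^ (-2 : ℝ)) *
      MixedMorrey d q₁ q₂ β (pCyl d R 0) (fun z => ENNReal.ofReal |u z|) ≤ ENNReal.ofReal a

lemma grad_est (d : ℕ) (hd : 1 ≤ d) {q₁ q₂ β : ℝ} (h1 : 1 < q₁) (h2 : 1 < q₂) (hβ : 1 < β) :
    ∃ C : ℝ, 0 < C ∧ ∀ (R : ℝ) (u : Pt d → ℝ) (a t : ℝ) (x : Ed d) (l : ℝ), 0 < R →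
      ContDiff ℝ (⊤ : ℕ∞) u → 0 < a → HypA d q₁ q₂ β R a u →
      (t, x) ∈ pCyl d R 0 → 0 < l → l ≤ 1 →
      ENNReal.ofReal (gradNorm d u (t, x)) ≤ ENNReal.ofReal C * (ENNReal.ofReal R *
        Tpot d R l (fun x' => ENNReal.ofReal (rhsF d u (t, x'))) x +
          ENNReal.ofReal ((l * R) ^ (1 - β) * a)) := by
  obtain ⟨C, hC, h⟩ := point_est d (q₁ := q₁) (q₂ := q₂) h1 h2 hβ
  have hd' : (0 : ℝ) < d := by exact_mod_cast hd
  refine ⟨d * C, by positivity, ?_⟩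
  intro R u a t x l hR hu ha hA hz hl hl1
  refine (gradNorm_le d u _).trans ?_
  refine (Finset.sum_le_sum fun i _ => h R u a t x l i hR hu ha hA hz hl hl1).trans_eq ?_
  rw [Finset.sum_const, Finset.card_univ, Fintype.card_fin, nsmul_eq_mul,
    ENNReal.ofReal_mul hd'.le, ENNReal.ofReal_natCast, mul_assoc]

lemma slice_est (d : ℕ) (hd : 1 ≤ d) {q₁ q₂ β r₁ : ℝ} (h1 : 1 < q₁) (h2 : 1 < q₂) (hβ : 1 < β)
    (hr₁ : r₁ * (β - 1) = q₁ * β) :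
    ∃ N : ℝ, 0 < N ∧ ∀ (R : ℝ) (u : Pt d → ℝ) (a t ρ : ℝ) (x₀ : Ed d), 0 < R →
      ContDiff ℝ (⊤ : ℕ∞) u → 0 < a → HypA d q₁ q₂ β R a u → t ∈ Ico 0 (R ^ 2) → 0 < ρ → ρ ≤ R →
      ∫⁻ x in Metric.ball x₀ ρ ∩ Metric.ball 0 R, ENNReal.ofReal (gradNorm d u (t, x) ^ r₁) ≤
        ENNReal.ofReal N * (ENNReal.ofReal (ρ ^ ((1 - β) * r₁) * a ^ r₁ * ρ ^ (d : ℝ)) +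
          ENNReal.ofReal (a ^ (q₁ / (β - 1))) *
            ∫⁻ x in Metric.ball x₀ (2 * ρ) ∩ Metric.ball 0 R, ENNReal.ofReal (rhsF d u (t, x) ^ q₁)) := by
  obtain ⟨C, hC, hg⟩ := grad_est d hd (q₁ := q₁) (q₂ := q₂) h1 h2 hβ
  obtain ⟨N, hN, hl⟩ := level_lemma d h1 hβ hr₁ hC
  have ho := om_pos d
  have hβ1 : 0 < β - 1 := by linarith
  have hr0 : 0 < r₁ := by
    by_contra h
    have : 0 < r₁ * (β - 1) := by rw [hr₁]; positivity
    nlinarith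
  refine ⟨N * (2 ^ ((β - 1) * r₁) * om d + 1), by positivity, ?_⟩
  intro R u a t ρ x₀ hR hu ha hA ht hρ hρR
  set B := Metric.ball x₀ (2 * ρ) ∩ Metric.ball 0 R with hB
  have hBm : MeasurableSet B := measurableSet_ball.inter measurableSet_ball
  have hFm : Measurable (fun x => rhsF d u (t, x)) :=
    ((rhsF_cont hu).comp (by fun_prop : Continuous fun x : Ed d => (t, x))).measurable
  have hvm : Measurable (fun x => gradNorm d u (t, x)) :=
    ((gradNorm_meas hu).comp (by fun_prop : Continuous fun x : Ed d => (t, x))).measurable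
  have key := hl R (R ^ (1 - β) * a) (ρ / (2 * R)) (Metric.ball x₀ ρ ∩ Metric.ball 0 R)
    (fun x => gradNorm d u (t, x)) (B.indicator fun x => R * rhsF d u (t, x)) (by positivity)
    (by positivity) (by rw [div_le_iff₀ (by positivity)]; linarith)
    (measurableSet_ball.inter measurableSet_ball) hvm (fun x => Real.sqrt_nonneg _)
    ((hFm.const_mul R).indicator hBm)
    (fun x => indicator_nonneg (fun x _ => mul_nonneg hR.le (rhsF_nonneg d u _)) x) ?_
  · refine key.trans ?_
    rw [ENNReal.ofReal_mul hN.le, mul_assoc]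
    refine mul_le_mul_right ?_ _
    have i1 : ∫⁻ x, ENNReal.ofReal (B.indicator (fun x => R * rhsF d u (t, x)) x ^ q₁) =
        ENNReal.ofReal (R ^ q₁) * ∫⁻ x in B, ENNReal.ofReal (rhsF d u (t, x) ^ q₁) := by
      rw [← lintegral_const_mul _ (by fun_prop), ← lintegral_indicator hBm]
      refine lintegral_congr fun x => ?_
      by_cases hx : x ∈ B
      · simp only [indicator_of_mem hx]
        rw [Real.mul_rpow hR.le (rhsF_nonneg d u _), ENNReal.ofReal_mul (by positivity)]
      · simp only [indicator_of_notMem hx]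
        rw [Real.zero_rpow (by linarith), ENNReal.ofReal_zero]
    rw [i1, ← mul_assoc (ENNReal.ofReal ((R ^ (1 - β) * a) ^ (q₁ / (β - 1)))), ← ENNReal.ofReal_mul (by positivity)]
    have i2 : (R ^ (1 - β) * a) ^ (q₁ / (β - 1)) * R ^ q₁ = a ^ (q₁ / (β - 1)) := by
      rw [Real.mul_rpow (by positivity) ha.le, ← Real.rpow_mul hR.le,
        show (1 - β) * (q₁ / (β - 1)) = - q₁ by field_simp; ring, Real.rpow_neg hR.le]
      field_simp
    rw [i2]
    have i3 : ((ρ / (2 * R)) ^ (1 - β) * (R ^ (1 - β) * a)) ^ r₁ =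
        2 ^ ((β - 1) * r₁) * (ρ ^ ((1 - β) * r₁) * a ^ r₁) := by
      rw [← mul_assoc, ← Real.mul_rpow (by positivity) hR.le,
        show ρ / (2 * R) * R = ρ * 2⁻¹ by field_simp, Real.mul_rpow (by positivity) ha.le,
        ← Real.rpow_mul (by positivity), Real.mul_rpow hρ.le (by norm_num), Real.inv_rpow (by norm_num),
        ← Real.rpow_neg (by norm_num), show -((1 - β) * r₁) = (β - 1) * r₁ by ring]
      ring
    have i4 : ENNReal.ofReal (((ρ / (2 * R)) ^ (1 - β) * (R ^ (1 - β) * a)) ^ r₁) *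
        volume (Metric.ball x₀ ρ ∩ Metric.ball 0 R) ≤ ENNReal.ofReal (2 ^ ((β - 1) * r₁) * om d) *
          ENNReal.ofReal (ρ ^ ((1 - β) * r₁) * a ^ r₁ * ρ ^ (d : ℝ)) := by
      refine (mul_le_mul_right (measure_mono inter_subset_left) _).trans_eq ?_
      rw [vol_ball d x₀ hρ, i3, ← ENNReal.ofReal_mul (by positivity), ← ENNReal.ofReal_mul (by positivity)]
      congr 1; ring
    refine (add_le_add_left i4 _).trans ?_
    rw [mul_add]
    refine add_le_add (mul_le_mul_left (ENNReal.ofReal_le_ofReal (by linarith)) _) ?_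
    refine le_mul_of_one_le_left zero_le ?_
    rw [← ENNReal.ofReal_one]
    refine ENNReal.ofReal_le_ofReal ?_
    have : 0 ≤ (2:ℝ) ^ ((β - 1) * r₁) * om d := by positivity
    linarith
  · intro x hx l hl0 hl1
    have hxR : ‖x‖ < R := by simpa using hx.2
    have hl2 : l * (2 * R) ≤ ρ := by rwa [le_div_iff₀ (by positivity)] at hl1
    refine (hg R u a t x l hR hu ha hA (mem_pCyl.2 ⟨by simpa using ht, by simpa using hxR⟩) hl0 (by
      nlinarith)).trans_eq ?_
    have e1 : (l * R) ^ (1 - β) * a = l ^ (1 - β) * (R ^ (1 - β) * a) := by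
      rw [Real.mul_rpow hl0.le hR.le, mul_assoc]
    rw [e1]
    congr 2
    unfold Tpot
    rw [← lintegral_const_mul' _ _ ENNReal.ofReal_ne_top]
    refine setLIntegral_congr_fun measurableSet_Ioo fun μ hμ => ?_
    simp only []
    rw [← lintegral_const_mul' _ _ ENNReal.ofReal_ne_top]
    refine setLIntegral_congr_fun measurableSet_ball fun y hy => ?_
    have hy1 : ‖y‖ < 1 := by simpa using hy
    have hmem : (1 - μ) • x + (μ * R) • y ∈ B := by
      have hRy : ‖R • y‖ ≤ R := by
        rw [norm_smul, Real.norm_of_nonneg hR.le]; nlinarith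
      have hl4 : l ≤ 1 / 2 := by nlinarith
      refine ⟨?_, ?_⟩
      · rw [Metric.mem_ball, dist_eq_norm]
        have : (1 - μ) • x + (μ * R) • y - x₀ = (x - x₀) + μ • (R • y - x) := by
          rw [smul_sub, smul_smul, sub_smul, one_smul]; abel
        rw [this]
        have hx1 : ‖x - x₀‖ < ρ := by simpa [dist_eq_norm] using hx.1
        have : ‖μ • (R • y - x)‖ ≤ ρ := by
          rw [norm_smul, Real.norm_of_nonneg hμ.1.le]
          have := norm_sub_le (R • y) x
          have hm := hμ.2
          have hm' := hμ.1
          calc μ * ‖R • y - x‖ ≤ l * (2 * R) := by gcongr; linarith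
            _ ≤ ρ := hl2
        linarith [norm_add_le (x - x₀) (μ • (R • y - x))]
      · rw [mem_ball_zero_iff]
        have hm : 0 < 1 - μ := by linarith [hμ.2]
        have n1 := norm_add_le ((1 - μ) • x) ((μ * R) • y)
        rw [mul_smul, norm_smul, norm_smul, Real.norm_of_nonneg hm.le, Real.norm_of_nonneg hμ.1.le] at n1
        rw [mul_smul]
        have := mul_lt_mul_of_pos_left hxR hm
        have := mul_le_mul_of_nonneg_left hRy hμ.1.le
        linarith
    simp only [indicator_of_mem hmem]
    rw [ENNReal.ofReal_mul hR.le]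

lemma mixed_mono (d : ℕ) {q₁ q₂ : ℝ} (h1 : 0 < q₁) (h2 : 0 < q₂) {f g : Pt d → ℝ≥0∞} (h : ∀ z, f z ≤ g z) :
    MixedNorm d q₁ q₂ f ≤ MixedNorm d q₁ q₂ g := by
  unfold MixedNorm
  refine ENNReal.rpow_le_rpow (lintegral_mono fun t => ENNReal.rpow_le_rpow
    (lintegral_mono fun x => ENNReal.rpow_le_rpow (h _) h1.le) (by positivity)) (by positivity)

lemma add_rpow_le (a b : ℝ≥0∞) {p : ℝ} (hp : 0 < p) : (a + b) ^ p ≤ ENNReal.ofReal (2 ^ p) * (a ^ p + b ^ p) := by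
  have h : a + b ≤ 2 * max a b := by
    rw [two_mul]; exact add_le_add (le_max_left _ _) (le_max_right _ _)
  refine (ENNReal.rpow_le_rpow h hp.le).trans ?_
  rw [ENNReal.mul_rpow_of_nonneg _ _ hp.le]
  have e : (2 : ℝ≥0∞) ^ p = ENNReal.ofReal (2 ^ p) := by
    rw [← ENNReal.ofReal_rpow_of_pos (by norm_num)]; simp
  rw [e]
  refine mul_le_mul_right ?_ _
  rcases max_choice a b with h | h <;> rw [h]
  · exact le_self_add
  · exact le_add_self

/-- A bound of the mixed norm on a cylinder by the Morrey norm. -/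
lemma mixed_of_morrey (d : ℕ) {q₁ q₂ β a ρ : ℝ} (h1 : 0 < q₁) (h2 : 0 < q₂) (hρ : 0 < ρ)
    {Q : Set (Pt d)} {z : Pt d} (hz : z ∈ Q) {f : Pt d → ℝ≥0∞}
    (h : MixedMorrey d q₁ q₂ β Q f ≤ ENNReal.ofReal a) :
    MixedNorm d q₁ q₂ ((pCyl d ρ z).indicator (Q.indicator f)) ≤
      ENNReal.ofReal (a * (om d ^ (1 / q₁) * ρ ^ ((d : ℝ) / q₁ + 2 / q₂ - β))) := by
  have ho := om_pos d
  have h' : ENNReal.ofReal (ρ ^ β) * MixedNormOn d q₁ q₂ (pCyl d ρ z) (Q.indicator f) ≤ ENNReal.ofReal a := by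
    refine le_trans ?_ h
    unfold MixedMorrey
    exact le_iSup₂_of_le ρ hρ (le_iSup₂_of_le z hz le_rfl)
  unfold MixedNormOn at h'
  rw [mixed_one d h1 h2 hρ] at h'
  set X := MixedNorm d q₁ q₂ ((pCyl d ρ z).indicator (Q.indicator f))
  have hc : 0 < om d ^ (1 / q₁) * ρ ^ ((d : ℝ) / q₁ + 2 / q₂) := by positivity
  rw [← ENNReal.ofReal_inv_of_pos hc, ← mul_assoc, ← ENNReal.ofReal_mul (by positivity)] at h'
  set c := om d ^ (1 / q₁) * ρ ^ ((d : ℝ) / q₁ + 2 / q₂) with hcd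
  have e : X = ENNReal.ofReal (c * (ρ ^ β)⁻¹) * (ENNReal.ofReal (ρ ^ β * c⁻¹) * X) := by
    rw [← mul_assoc, ← ENNReal.ofReal_mul (by positivity)]
    have : c * (ρ ^ β)⁻¹ * (ρ ^ β * c⁻¹) = 1 := by
      have := Real.rpow_pos_of_pos hρ β
      field_simp
    rw [this]; simp
  rw [e]
  refine (mul_le_mul_right h' _).trans_eq ?_
  rw [← ENNReal.ofReal_mul (by positivity), hcd, Real.rpow_sub hρ]
  congr 1; ring

lemma local_est (d : ℕ) (hd : 1 ≤ d) {q₁ q₂ β r₁ r₂ : ℝ} (h1 : 1 < q₁) (h2 : 1 < q₂) (hβ : 1 < β)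
    (hr₁ : r₁ * (β - 1) = q₁ * β) (hr₂ : r₂ * (β - 1) = q₂ * β) :
    ∃ N : ℝ, 0 < N ∧ ∀ (R : ℝ) (u : Pt d → ℝ) (a ρ : ℝ) (z : Pt d), 0 < R →
      ContDiff ℝ (⊤ : ℕ∞) u → 0 < a → HypA d q₁ q₂ β R a u → z ∈ pCyl d R 0 → 0 < ρ → ρ ≤ R →
      ENNReal.ofReal (ρ ^ (β - 1)) * MixedNormOn d r₁ r₂ (pCyl d ρ z) ((pCyl d R 0).indicator
        (fun z => ENNReal.ofReal (gradNorm d u z))) ≤ ENNReal.ofReal (N * a) := by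
  obtain ⟨N, hN, hs⟩ := slice_est d hd (q₁ := q₁) (q₂ := q₂) h1 h2 hβ hr₁
  have ho := om_pos d
  have hβ1 : 0 < β - 1 := by linarith
  have hq1 : 0 < q₁ := by linarith
  have hq2 : 0 < q₂ := by linarith
  have e1 : r₁ = q₁ * β / (β - 1) := by field_simp; linarith
  have e2 : r₂ = q₂ * β / (β - 1) := by field_simp; linarith
  have hr1 : 0 < r₁ := by rw [e1]; positivity
  have hr2 : 0 < r₂ := by rw [e2]; positivity
  set p := q₂ / q₁ with hp
  have hp0 : 0 < p := by positivity
  have hpr : r₂ / r₁ = p := by rw [e1, e2, hp]; field_simp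
  set e : ℝ := 2 + d * p - β * q₂ with he
  set M : ℝ := N ^ p * 2 ^ p * (1 + om d ^ p * 2 ^ e) with hM
  have hM0 : 0 < M := by positivity
  refine ⟨M ^ (1 / r₂) * (om d ^ (1 / r₁))⁻¹, by positivity, ?_⟩
  intro R u a ρ z hR hu ha hA hz hρ hρR
  obtain ⟨t₀, x₀⟩ := z
  set Q := pCyl d R 0 with hQ
  set F : Pt d → ℝ≥0∞ := Q.indicator (fun z => ENNReal.ofReal (rhsF d u z)) with hF
  have hFM : MixedMorrey d q₁ q₂ β Q (fun z => ENNReal.ofReal (rhsF d u z)) ≤ ENNReal.ofReal a :=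
    le_self_add.trans hA
  have h2ρ : 0 < 2 * ρ := by positivity
  have hbig := mixed_of_morrey d hq1 hq2 h2ρ hz hFM
  rw [mixed_ind d hq1 hq2] at hbig
  simp only at hbig
  set c1 : ℝ := ρ ^ ((1 - β) * r₁) * a ^ r₁ * ρ ^ (d : ℝ) with hc1
  set c2 : ℝ := a ^ (q₁ / (β - 1)) with hc2
  have hc10 : 0 < c1 := by positivity
  have hc20 : 0 < c2 := by positivity
  set G : ℝ → ℝ≥0∞ := fun t => ∫⁻ x in Metric.ball x₀ (2 * ρ), F (t, x) ^ q₁ with hG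
  have hFm : Measurable F := (rhsF_cont hu).measurable.ennreal_ofReal.indicator (pCyl_meas d R 0)
  have hGm : Measurable G := (hFm.pow_const q₁).lintegral_prod_right'
  have inner : ∀ t, ∫⁻ x in Metric.ball x₀ ρ, (Q.indicator (fun z => ENNReal.ofReal (gradNorm d u z)) (t, x)) ^ r₁
      ≤ ENNReal.ofReal N * (ENNReal.ofReal c1 + ENNReal.ofReal c2 * G t) := by
    intro t
    by_cases ht : t ∈ Ico 0 (R ^ 2)
    · have hmem : ∀ x : Ed d, (t, x) ∈ Q ↔ x ∈ Metric.ball (0 : Ed d) R := by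
        intro x
        rw [hQ, mem_pCyl]
        simp only [Prod.fst_zero, zero_add, Prod.snd_zero, ht, true_and]
      have conv : ∀ (f : Pt d → ℝ) (hf : ∀ z, 0 ≤ f z) (k : ℝ) (hk : 0 < k) (σ : ℝ),
          ∫⁻ x in Metric.ball x₀ σ, (Q.indicator (fun z => ENNReal.ofReal (f z)) (t, x)) ^ k =
          ∫⁻ x in Metric.ball x₀ σ ∩ Metric.ball 0 R, ENNReal.ofReal (f (t, x) ^ k) := by
        intro f hf k hk σ
        rw [inter_comm, ← Measure.restrict_restrict measurableSet_ball,
          ← lintegral_indicator (s := Metric.ball (0 : Ed d) R) measurableSet_ball]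
        refine lintegral_congr fun x => ?_
        by_cases hx : x ∈ Metric.ball (0 : Ed d) R
        · rw [indicator_of_mem ((hmem x).2 hx), indicator_of_mem hx,
            ENNReal.ofReal_rpow_of_nonneg (hf _) hk.le]
        · rw [indicator_of_notMem (fun h => hx ((hmem x).1 h)), indicator_of_notMem hx,
            ENNReal.zero_rpow_of_pos hk]
      have := hs R u a t ρ x₀ hR hu ha hA ht hρ hρR
      rw [← conv (gradNorm d u) (fun z => Real.sqrt_nonneg _) r₁ hr1 ρ,
        ← conv (rhsF d u) (rhsF_nonneg d u) q₁ hq1 (2 * ρ)] at this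
      exact this
    · have : ∀ x : Ed d, (t, x) ∉ Q := by
        intro x hx
        rw [hQ, mem_pCyl] at hx
        exact ht (by simpa using hx.1)
      simp [this, hr1]
  unfold MixedNormOn
  rw [mixed_one d hr1 hr2 hρ, mixed_ind d hr1 hr2, hpr]
  simp only
  have tot : ∫⁻ t in Ico t₀ (t₀ + ρ ^ 2), (∫⁻ x in Metric.ball x₀ ρ,
      (Q.indicator (fun z => ENNReal.ofReal (gradNorm d u z)) (t, x)) ^ r₁) ^ p ≤
      ENNReal.ofReal (M * a ^ r₂ * ρ ^ e) := by
    calc _ ≤ ∫⁻ t in Ico t₀ (t₀ + ρ ^ 2), ENNReal.ofReal (N ^ p * 2 ^ p) *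
          (ENNReal.ofReal (c1 ^ p) + ENNReal.ofReal (c2 ^ p) * G t ^ p) := by
          refine lintegral_mono fun t => ?_
          refine (ENNReal.rpow_le_rpow (inner t) hp0.le).trans ?_
          rw [ENNReal.mul_rpow_of_nonneg _ _ hp0.le, ENNReal.ofReal_rpow_of_pos hN,
            ENNReal.ofReal_mul (p := N ^ p) (by positivity), mul_assoc]
          refine mul_le_mul_right ((add_rpow_le _ _ hp0).trans_eq ?_) _
          rw [ENNReal.mul_rpow_of_nonneg _ _ hp0.le, ENNReal.ofReal_rpow_of_pos hc10,
            ENNReal.ofReal_rpow_of_pos hc20]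
      _ = ENNReal.ofReal (N ^ p * 2 ^ p) * (ENNReal.ofReal (c1 ^ p * ρ ^ 2) +
          ENNReal.ofReal (c2 ^ p) * ∫⁻ t in Ico t₀ (t₀ + ρ ^ 2), G t ^ p) := by
          rw [lintegral_const_mul _ (by fun_prop), lintegral_add_left measurable_const,
            lintegral_const_mul _ (by fun_prop), setLIntegral_const, Real.volume_Ico,
            ← ENNReal.ofReal_mul (by positivity)]
          congr 4; ring
      _ ≤ ENNReal.ofReal (N ^ p * 2 ^ p) * (ENNReal.ofReal (c1 ^ p * ρ ^ 2) +
          ENNReal.ofReal (c2 ^ p) * ENNReal.ofReal ((a * (om d ^ (1 / q₁) *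
            (2 * ρ) ^ ((d : ℝ) / q₁ + 2 / q₂ - β))) ^ q₂)) := by
          refine mul_le_mul_right (add_le_add_right (mul_le_mul_right ?_ _) _) _
          have hsub : Ico t₀ (t₀ + ρ ^ 2) ⊆ Ico t₀ (t₀ + (2 * ρ) ^ 2) :=
            Ico_subset_Ico le_rfl (by nlinarith [sq_nonneg ρ])
          refine (lintegral_mono_set hsub).trans ?_
          rw [← ENNReal.ofReal_rpow_of_pos (by positivity), ← ENNReal.rpow_inv_le_iff hq2, ← one_div]
          exact hbig
      _ = ENNReal.ofReal (M * a ^ r₂ * ρ ^ e) := by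
          rw [← ENNReal.ofReal_mul (by positivity), ← ENNReal.ofReal_add (by positivity) (by positivity),
            ← ENNReal.ofReal_mul (by positivity)]
          congr 1
          have k1 : c1 ^ p * ρ ^ 2 = a ^ r₂ * ρ ^ e := by
            rw [hc1, Real.mul_rpow (by positivity) (by positivity),
              Real.mul_rpow (by positivity) (by positivity), ← Real.rpow_mul hρ.le, ← Real.rpow_mul hρ.le,
              ← Real.rpow_mul ha.le, ← Real.rpow_natCast ρ 2]
            have : r₁ * p = r₂ := by rw [← hpr]; field_simp
            rw [this, mul_comm (ρ ^ _) (a ^ _), mul_assoc, mul_assoc, ← Real.rpow_add hρ, ← Real.rpow_add hρ]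
            congr 2
            rw [he, mul_assoc, this]
            push_cast
            nlinarith
          have k2 : c2 ^ p * (a * (om d ^ (1 / q₁) * (2 * ρ) ^ ((d : ℝ) / q₁ + 2 / q₂ - β))) ^ q₂ =
              om d ^ p * 2 ^ e * (a ^ r₂ * ρ ^ e) := by
            rw [hc2, Real.mul_rpow ha.le (by positivity), Real.mul_rpow (by positivity) (by positivity),
              ← Real.rpow_mul ha.le, ← Real.rpow_mul ho.le, ← Real.rpow_mul (by positivity),
              show ((d : ℝ) / q₁ + 2 / q₂ - β) * q₂ = e by rw [he, hp]; field_simp; ring,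
              show 1 / q₁ * q₂ = p by rw [hp]; ring, Real.mul_rpow (by norm_num) hρ.le,
              show r₂ = q₁ / (β - 1) * p + q₂ by rw [e2, hp]; field_simp; ring, Real.rpow_add ha]
            ring
          rw [k1, k2, hM]; ring
  have fin : (∫⁻ t in Ico t₀ (t₀ + ρ ^ 2), (∫⁻ x in Metric.ball x₀ ρ,
      (Q.indicator (fun z => ENNReal.ofReal (gradNorm d u z)) (t, x)) ^ r₁) ^ p) ^ (1 / r₂) ≤
      ENNReal.ofReal (M ^ (1 / r₂) * a * ρ ^ (e / r₂)) := by
    refine (ENNReal.rpow_le_rpow tot (by positivity)).trans_eq ?_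
    rw [ENNReal.ofReal_rpow_of_pos (by positivity), Real.mul_rpow (by positivity) (by positivity),
      Real.mul_rpow (by positivity) (by positivity), ← Real.rpow_mul ha.le, ← Real.rpow_mul hρ.le,
      mul_one_div_cancel hr2.ne', Real.rpow_one, mul_one_div]
  refine (mul_le_mul_right (mul_le_mul_right fin _) _).trans_eq ?_
  rw [← ENNReal.ofReal_inv_of_pos (by positivity), ← ENNReal.ofReal_mul (by positivity),
    ← ENNReal.ofReal_mul (by positivity)]
  congr 1
  have k3 : ρ ^ (e / r₂) = ρ ^ ((d : ℝ) / r₁ + 2 / r₂) * (ρ ^ (β - 1))⁻¹ := by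
    rw [← Real.rpow_neg hρ.le, ← Real.rpow_add hρ]
    congr 1
    rw [he, e1, e2, hp]; field_simp; ring
  rw [k3]
  have := Real.rpow_pos_of_pos hρ (β - 1)
  have := Real.rpow_pos_of_pos hρ ((d : ℝ) / r₁ + 2 / r₂)
  field_simp

lemma big_est (d : ℕ) {r₁ r₂ γ : ℝ} (hr1 : 0 < r₁) (hr2 : 0 < r₂) (hγ : γ ≤ (d : ℝ) / r₁ + 2 / r₂)
    {R ρ : ℝ} (hR : 0 < R) (hρ : R ≤ ρ) (z : Pt d) (f : Pt d → ℝ≥0∞) :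
    ENNReal.ofReal (ρ ^ γ) * MixedNormOn d r₁ r₂ (pCyl d ρ z) ((pCyl d R 0).indicator f) ≤
      ENNReal.ofReal (R ^ γ) * MixedNormOn d r₁ r₂ (pCyl d R 0) ((pCyl d R 0).indicator f) := by
  have hρ0 : 0 < ρ := hR.trans_le hρ
  have ho := om_pos d
  unfold MixedNormOn
  rw [mixed_one d hr1 hr2 hρ0, mixed_one d hr1 hr2 hR, ← mul_assoc, ← mul_assoc,
    ← ENNReal.ofReal_inv_of_pos (by positivity), ← ENNReal.ofReal_inv_of_pos (by positivity),
    ← ENNReal.ofReal_mul (by positivity), ← ENNReal.ofReal_mul (by positivity)]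
  refine mul_le_mul' (ENNReal.ofReal_le_ofReal ?_) (mixed_mono d hr1 hr2 fun w => ?_)
  · have k : ∀ σ : ℝ, 0 < σ → σ ^ γ * (om d ^ (1 / r₁) * σ ^ ((d : ℝ) / r₁ + 2 / r₂))⁻¹ =
        (om d ^ (1 / r₁))⁻¹ * σ ^ (γ - ((d : ℝ) / r₁ + 2 / r₂)) := by
      intro σ hσ
      rw [Real.rpow_sub hσ, mul_inv]; ring
    rw [k _ hρ0, k _ hR]
    refine mul_le_mul_of_nonneg_left ?_ (by positivity)
    exact Real.rpow_le_rpow_of_nonpos hR hρ (by linarith)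
  · rw [indicator_indicator, indicator_indicator, inter_self]
    exact indicator_le_indicator_of_subset inter_subset_right (fun _ => zero_le) w

theorem main_est (d : ℕ) (hd : 1 ≤ d) (q₁ q₂ β r₁ r₂ : ℝ) (hq₁ : 1 < q₁) (hq₂ : 1 < q₂)
    (hβ : 1 < β) (hβ' : β ≤ (d : ℝ) / q₁ + 2 / q₂)
    (hr₁ : r₁ * (β - 1) = q₁ * β) (hr₂ : r₂ * (β - 1) = q₂ * β) :
    ∃ N : ℝ, 0 < N ∧ ∀ R : ℝ, 0 < R →
      ∀ u : Pt d → ℝ, ContDiff ℝ (⊤ : ℕ∞) u → HasCompactSupport u →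
        MixedMorrey d r₁ r₂ (β - 1) (pCyl d R 0)
            (fun z => ENNReal.ofReal (gradNorm d u z)) ≤
          ENNReal.ofReal N * MixedMorrey d q₁ q₂ β (pCyl d R 0)
              (fun z => ENNReal.ofReal (|timeDeriv d u z| + hessNorm d u z)) +
            ENNReal.ofReal (N * R ^ (-2 : ℝ)) * MixedMorrey d q₁ q₂ β (pCyl d R 0)
              (fun z => ENNReal.ofReal |u z|) := by
  obtain ⟨N, hN, hl⟩ := local_est d hd hq₁ hq₂ hβ hr₁ hr₂
  refine ⟨N, hN, fun R hR u hu _ => ?_⟩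
  have hβ1 : 0 < β - 1 := by linarith
  have e1 : r₁ = q₁ * β / (β - 1) := by field_simp; linarith
  have e2 : r₂ = q₂ * β / (β - 1) := by field_simp; linarith
  have hr1 : 0 < r₁ := by rw [e1]; positivity
  have hr2 : 0 < r₂ := by rw [e2]; positivity
  have hγ : β - 1 ≤ (d : ℝ) / r₁ + 2 / r₂ := by
    have : (d : ℝ) / r₁ + 2 / r₂ = ((d : ℝ) / q₁ + 2 / q₂) * ((β - 1) / β) := by
      rw [e1, e2]; field_simp
    rw [this]
    calc β - 1 = β * ((β - 1) / β) := by field_simp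
      _ ≤ _ := by gcongr
  rw [ENNReal.ofReal_mul hN.le, mul_assoc, ← mul_add]
  set A := MixedMorrey d q₁ q₂ β (pCyl d R 0)
              (fun z => ENNReal.ofReal (|timeDeriv d u z| + hessNorm d u z)) +
            ENNReal.ofReal (R ^ (-2 : ℝ)) * MixedMorrey d q₁ q₂ β (pCyl d R 0)
              (fun z => ENNReal.ofReal |u z|) with hA
  by_cases hT : A = ⊤
  · rw [hT, ENNReal.mul_top (by simpa using hN)]; exact le_top
  have bound : ∀ ε : ℝ, 0 < ε → MixedMorrey d r₁ r₂ (β - 1) (pCyl d R 0)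
            (fun z => ENNReal.ofReal (gradNorm d u z)) ≤ ENNReal.ofReal (N * (A.toReal + ε)) := by
    intro ε hε
    have hHA : HypA d q₁ q₂ β R (A.toReal + ε) u := by
      unfold HypA
      change A ≤ _
      rw [← ENNReal.ofReal_toReal hT]
      refine ENNReal.ofReal_le_ofReal ?_
      rw [ENNReal.toReal_ofReal ENNReal.toReal_nonneg]
      linarith
    have hpos : 0 < A.toReal + ε := by have := ENNReal.toReal_nonneg (a := A); linarith
    conv_lhs => unfold MixedMorrey
    refine iSup₂_le fun ρ hρ => iSup₂_le fun z hz => ?_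
    rcases le_total ρ R with h | h
    · exact hl R u _ ρ z hR hu hpos hHA hz hρ h
    · refine (big_est d hr1 hr2 hγ hR h z _).trans ?_
      refine hl R u _ R 0 hR hu hpos hHA ?_ hR le_rfl
      rw [mem_pCyl]
      simp [hR, pow_pos hR 2]
  have : ENNReal.ofReal N * A = ENNReal.ofReal (N * A.toReal) := by
    rw [ENNReal.ofReal_mul hN.le, ENNReal.ofReal_toReal hT]
  rw [this]
  refine ENNReal.le_of_forall_pos_le_add fun ε hε _ => ?_
  have hε' : 0 < (ε : ℝ) := hε
  refine (bound (ε / N) (by positivity)).trans_eq ?_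
  rw [mul_add, mul_div_cancel₀ _ hN.ne', ENNReal.ofReal_add (by positivity) hε'.le, ENNReal.ofReal_coe_nnreal]

/-- Theorem 5.11: for `q₁, q₂ ∈ (1,∞)`, `1 < β ≤ d/q₁ + 2/q₂` and
`rᵢ(β−1) = qᵢβ`, one has
`‖Du‖_{E_{r₁,r₂,β−1}(C_R)} ≤ N ‖|∂_t u|+|D²u|‖_{E_{q₁,q₂,β}(C_R)} + N R^{-2} ‖u‖_{E_{q₁,q₂,β}(C_R)}`. -/
theorem stmt19 (d : ℕ) (hd : 1 ≤ d) (q₁ q₂ β r₁ r₂ : ℝ) (hq₁ : 1 < q₁) (hq₂ : 1 < q₂)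
    (hβ : 1 < β) (hβ' : β ≤ (d : ℝ) / q₁ + 2 / q₂)
    (hr₁ : r₁ * (β - 1) = q₁ * β) (hr₂ : r₂ * (β - 1) = q₂ * β) :
    ∃ N : ℝ, 0 < N ∧ ∀ R : ℝ, 0 < R →
      ∀ u : Pt d → ℝ, ContDiff ℝ (⊤ : ℕ∞) u → HasCompactSupport u →
        MixedMorrey d r₁ r₂ (β - 1) (pCyl d R 0)
            (fun z => ENNReal.ofReal (gradNorm d u z)) ≤
          ENNReal.ofReal N * MixedMorrey d q₁ q₂ β (pCyl d R 0)
              (fun z => ENNReal.ofReal (|timeDeriv d u z| + hessNorm d u z)) +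
            ENNReal.ofReal (N * R ^ (-2 : ℝ)) * MixedMorrey d q₁ q₂ β (pCyl d R 0)
              (fun z => ENNReal.ofReal |u z|) := by
  exact main_est d hd q₁ q₂ β r₁ r₂ hq₁ hq₂ hβ hβ' hr₁ hr₂
end
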